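/- arXiv:1710.08253 — 5 statements merged into one kernel-verified Lean document; each statement's English description precedes it below -/
import Mathlib

section
/- Let V be a faithful finite-dimensional complex representation of a finite group G with character χ_V. Suppose a is an integer value of χ_V achieved on m different conjugacy classes of G. Then the critical group K(V) contains a subgroup isomorphic to (ℤ/(dim(V) − a)ℤ)^{m−1}. -/
/- The representation ring `R(G)` of a finite group `G` is modeled as the ring of virtual
characters: the ℤ-span of the characters of finite-dimensional complex representations,
inside the ring `G → ℂ` (a faithful model in characteristic zero).  Under this
identification, multiplication by the class of a representation is pointwise
multiplication by its character, the dimension homomorphism is evaluation at `1`, and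
restriction of representations is precomposition of characters. -/

open CategoryTheory

noncomputable def repRing (G : Type) [Group G] [Fintype G] : Submodule ℤ (G → ℂ) :=
  Submodule.span ℤ {f | ∃ V : FDRep ℂ G, f = V.character}

/-- `R₀(G)`: virtual characters of virtual dimension `0`. -/
noncomputable def R0 (G : Type) [Group G] [Fintype G] : Submodule ℤ (G → ℂ) :=
  repRing G ⊓ LinearMap.ker
    (((LinearMap.proj (1 : G)) : (G → ℂ) →ₗ[ℂ] ℂ).restrictScalars ℤ)

/-- the "character" of the element `dim(V)·[1_G] − [V]`; multiplication by this function
is the map `C̃_V` (and `C_V`, on `R₀(G)`). -/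
noncomputable def cfun (G : Type) [Group G] [Fintype G] (χ : G → ℂ) : G → ℂ :=
  fun g => χ 1 - χ g

/-- the image of `C_V : R₀(G) → R₀(G)`, as a submodule of `R₀(G)`. -/
noncomputable def critIm (G : Type) [Group G] [Fintype G] (χ : G → ℂ) :
    Submodule ℤ (R0 G) :=
  (Submodule.map (LinearMap.mulLeft ℤ (cfun G χ)) (R0 G)).comap (R0 G).subtype

/-- the critical group `K(V) = coker(C_V : R₀(G) → R₀(G))`, where `χ = χ_V`. -/
noncomputable abbrev Kgroup (G : Type) [Group G] [Fintype G] (χ : G → ℂ) :=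
  R0 G ⧸ critIm G χ

/-- Roots of the characteristic polynomial of an endomorphism of finite order are roots of unity. -/
lemma pow_eq_one_of_mem_roots_charpoly {W : Type*} [AddCommGroup W] [Module ℂ W]
    [FiniteDimensional ℂ W] {f : Module.End ℂ W} {n : ℕ} (hf : f ^ n = 1) {μ : ℂ}
    (hμ : μ ∈ f.charpoly.roots) : μ ^ n = 1 := by
  have h1 : f.HasEigenvalue μ := by
    rw [Module.End.hasEigenvalue_iff_isRoot_charpoly]
    exact (Polynomial.mem_roots'.1 hμ).2
  obtain ⟨v, hv⟩ := h1.exists_hasEigenvector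
  have h2 := hv.pow_apply n
  rw [hf] at h2
  have h3 : (μ ^ n - 1) • v = 0 := by
    rw [sub_smul, ← h2]; simp
  exact sub_eq_zero.1 ((smul_eq_zero.1 h3).resolve_right hv.2)

lemma trace_eq_sum_roots_charpoly {W : Type*} [AddCommGroup W] [Module ℂ W]
    [FiniteDimensional ℂ W] (f : Module.End ℂ W) :
    LinearMap.trace ℂ W f = f.charpoly.roots.sum :=
  Module.End.trace_eq_sum_roots_charpoly_of_splits (IsAlgClosed.splits _)

lemma isSemisimple_of_pow_eq_one {W : Type*} [AddCommGroup W] [Module ℂ W]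
    {f : Module.End ℂ W} {n : ℕ} (hn : n ≠ 0) (hf : f ^ n = 1) :
    f.IsSemisimple := by
  refine Module.End.isSemisimple_of_squarefree_aeval_eq_zero
    (p := Polynomial.X ^ n - 1) ?_ (by simp [hf])
  have : (Polynomial.X ^ n - Polynomial.C (1 : ℂ)).Separable :=
    Polynomial.separable_X_pow_sub_C (1 : ℂ) (by exact_mod_cast hn) one_ne_zero
  simpa using this.squarefree

lemma iSup_eigenspace_eq_top {W : Type*} [AddCommGroup W] [Module ℂ W]
    [FiniteDimensional ℂ W] {f : Module.End ℂ W} {n : ℕ} (hn : n ≠ 0) (hf : f ^ n = 1) :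
    ⨆ μ, f.eigenspace μ = ⊤ := by
  rw [← (isSemisimple_of_pow_eq_one hn
    hf).isFinitelySemisimple.iSup_maxGenEigenspace_eq_top_iff]
  exact Module.End.iSup_maxGenEigenspace_eq_top f

/-- An endomorphism of finite order whose trace has real part at least the dimension is the
identity. -/
lemma eq_one_of_finrank_le_re_trace {W : Type*} [AddCommGroup W] [Module ℂ W]
    [FiniteDimensional ℂ W] {f : Module.End ℂ W} {n : ℕ} (hn : n ≠ 0) (hf : f ^ n = 1)
    (htr : (Module.finrank ℂ W : ℝ) ≤ (LinearMap.trace ℂ W f).re) : f = 1 := by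
  have hroots : ∀ μ ∈ f.charpoly.roots, μ = 1 := by
    by_contra! hcon
    obtain ⟨μ, hμ, hμ1⟩ := hcon
    have hnorm : ∀ ν ∈ f.charpoly.roots, ‖ν‖ = 1 := fun ν hν =>
      Complex.norm_eq_one_of_pow_eq_one (pow_eq_one_of_mem_roots_charpoly hf hν) hn
    have hre : ∀ ν ∈ f.charpoly.roots, ν.re ≤ 1 := fun ν hν =>
      (Complex.re_le_norm ν).trans (hnorm ν hν).le
    have hμre : μ.re < 1 := by
      refine lt_of_le_of_ne (hre μ hμ) fun h => hμ1 ?_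
      have h2 : μ.re ^ 2 + μ.im ^ 2 = 1 := by
        have := Complex.sq_norm μ
        rw [hnorm μ hμ, Complex.normSq_apply] at this
        nlinarith
      have him : μ.im = 0 := by rw [h] at h2; nlinarith
      exact Complex.ext h him
    have hlt : (f.charpoly.roots.map Complex.re).sum < (f.charpoly.roots.map fun _ => (1 : ℝ)).sum :=
      Multiset.sum_lt_sum hre ⟨μ, hμ, hμre⟩
    have hcard : Multiset.card f.charpoly.roots = Module.finrank ℂ W := by
      rw [← LinearMap.charpoly_natDegree f]
      exact (IsAlgClosed.splits f.charpoly).natDegree_eq_card_roots.symm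
    rw [trace_eq_sum_roots_charpoly] at htr
    have hs : (f.charpoly.roots.sum).re = (f.charpoly.roots.map Complex.re).sum :=
      map_multiset_sum Complex.reAddGroupHom _
    rw [hs] at htr
    simp [hcard] at hlt
    linarith
  have htop := iSup_eigenspace_eq_top hn hf
  have hle : (⨆ μ, f.eigenspace μ) ≤ f.eigenspace 1 := by
    refine iSup_le fun μ => ?_
    by_cases h : f.HasEigenvalue μ
    · have : μ = 1 := hroots μ (by
        rw [Polynomial.mem_roots f.charpoly_monic.ne_zero,
          ← Module.End.hasEigenvalue_iff_isRoot_charpoly]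
        exact h)
      rw [this]
    · rw [Module.End.hasEigenvalue_iff, not_not] at h
      simp [h]
  ext v
  have : v ∈ f.eigenspace 1 := hle (htop ▸ Submodule.mem_top)
  simpa [Module.End.mem_eigenspace_iff] using this

/-- The trace of `ρ x` composed with a finite-order endomorphism commuting with the action is a
complex linear combination of characters. -/
lemma trace_comp_mem_span_character {G : Type} [Group G] {W : Type} [AddCommGroup W] [Module ℂ W]
    [FiniteDimensional ℂ W] (ρ : Representation ℂ G W) {A : Module.End ℂ W} {n : ℕ} (hn : n ≠ 0)
    (hA : A ^ n = 1) (hcomm : ∀ x, Commute A (ρ x)) :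
    (fun x => LinearMap.trace ℂ W (ρ x * A)) ∈
      Submodule.span ℂ {f : G → ℂ | ∃ V : FDRep ℂ G, f = V.character} := by
  classical
  have hmaps : ∀ x μ, Set.MapsTo (ρ x) (A.eigenspace μ) (A.eigenspace μ) := fun x μ =>
    Module.End.mapsTo_genEigenspace_of_comm (hcomm x) μ 1
  have hmapsA : ∀ μ, Set.MapsTo A (A.eigenspace μ) (A.eigenspace μ) := fun μ =>
    Module.End.mapsTo_genEigenspace_of_comm (Commute.refl A) μ 1
  let σ : ∀ μ, Representation ℂ G (A.eigenspace μ) := fun μ =>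
    { toFun := fun x => (ρ x).restrict (hmaps x μ)
      map_one' := by ext; simp
      map_mul' := fun x y => by
        refine LinearMap.ext fun v => Subtype.ext ?_
        change ρ (x * y) v = ρ x (ρ y v)
        rw [map_mul, Module.End.mul_apply] }
  have hint : DirectSum.IsInternal fun μ => A.eigenspace μ :=
    DirectSum.isInternal_submodule_of_iSupIndep_of_iSup_eq_top A.eigenspaces_iSupIndep
      (iSup_eigenspace_eq_top hn hA)
  have hfin : {μ | A.eigenspace μ ≠ ⊥}.Finite :=
    WellFoundedGT.finite_ne_bot_of_iSupIndep A.eigenspaces_iSupIndep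
  have key : (fun x => LinearMap.trace ℂ W (ρ x * A)) =
      ∑ μ ∈ hfin.toFinset, μ • (FDRep.of (σ μ)).character := by
    ext x
    rw [LinearMap.trace_eq_sum_trace_restrict' hint hfin (f := ρ x * A)
      (fun μ => (hmaps x μ).comp (hmapsA μ))]
    rw [Finset.sum_apply]
    refine Finset.sum_congr rfl fun μ _ => ?_
    have : (ρ x * A).restrict ((hmaps x μ).comp (hmapsA μ)) = μ • σ μ x := by
      ext ⟨v, hv⟩
      rw [Module.End.mem_eigenspace_iff] at hv
      change ρ x (A v) = μ • ρ x v
      rw [hv, map_smul]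
    rw [this, map_smul]
    rfl
  rw [key]
  exact Submodule.sum_mem _ fun μ _ => Submodule.smul_mem _ _ (Submodule.subset_span ⟨_, rfl⟩)

/-- Complex linear combinations of characters contain functions supported on a single
conjugacy class. -/
lemma exists_mem_span_character_ne_zero_iff_isConj {G : Type} [Group G] [Fintype G] (g : G) :
    ∃ f ∈ Submodule.span ℂ {f : G → ℂ | ∃ V : FDRep ℂ G, f = V.character},
      ∀ x, f x ≠ 0 ↔ IsConj g x := by
  classical
  let ρ : Representation ℂ G (G → ℂ) :=
    { toFun := fun x => LinearMap.funLeft ℂ ℂ fun y => x⁻¹ * y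
      map_one' := by ext; simp [LinearMap.funLeft]
      map_mul' := fun x y => by
        refine LinearMap.ext fun f => funext fun z => ?_
        simp [LinearMap.funLeft, mul_assoc] }
  let A : Module.End ℂ (G → ℂ) := LinearMap.funLeft ℂ ℂ fun y => y * g
  have hpow : ∀ k : ℕ, A ^ k = LinearMap.funLeft ℂ ℂ fun y => y * g ^ k := by
    intro k
    induction k with
    | zero => ext; simp [LinearMap.funLeft]
    | succ k ih =>
      rw [pow_succ, ih]
      refine LinearMap.ext fun f => funext fun z => ?_
      simp [A, LinearMap.funLeft, pow_succ, mul_assoc]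
  refine ⟨_, trace_comp_mem_span_character ρ (A := A) (n := orderOf g) (orderOf_pos g).ne' ?_ ?_, ?_⟩
  · rw [hpow, pow_orderOf_eq_one]
    ext; simp [LinearMap.funLeft]
  · intro x
    refine LinearMap.ext fun f => funext fun z => ?_
    simp [A, ρ, LinearMap.funLeft, mul_assoc]
  · intro x
    have htr : LinearMap.trace ℂ (G → ℂ) (ρ x * A) =
        ((Finset.univ.filter fun y : G => x⁻¹ * y * g = y).card : ℂ) := by
      rw [LinearMap.trace_eq_matrix_trace ℂ (Pi.basisFun ℂ G), Matrix.trace]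
      simp [ρ, A, LinearMap.funLeft, Pi.single_apply]
    simp only [htr]
    rw [Nat.cast_ne_zero, Finset.card_ne_zero, isConj_iff]
    constructor
    · rintro ⟨y, hy⟩
      refine ⟨y, ?_⟩
      simp only [Finset.mem_filter, Finset.mem_univ, true_and] at hy
      rw [mul_assoc, inv_mul_eq_iff_eq_mul] at hy
      rw [hy, mul_inv_cancel_right]
    · rintro ⟨y, hy⟩
      exact ⟨y, by simp [← hy, mul_assoc]⟩

lemma repRing_mul_mem {G : Type} [Group G] [Fintype G] {f h : G → ℂ} (hf : f ∈ repRing G)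
    (hh : h ∈ repRing G) : f * h ∈ repRing G := by
  have hle : repRing G * repRing G ≤ repRing G := by
    rw [repRing, Submodule.span_mul_span]
    refine Submodule.span_mono ?_
    rintro _ ⟨_, ⟨V, rfl⟩, _, ⟨W, rfl⟩, rfl⟩
    exact ⟨MonoidalCategory.tensorObj V W, (FDRep.char_tensor V W).symm⟩
  exact hle (Submodule.mul_mem_mul hf hh)

lemma character_mem_repRing {G : Type} [Group G] [Fintype G] (V : FDRep ℂ G) :
    V.character ∈ repRing G :=
  Submodule.subset_span ⟨V, rfl⟩

lemma one_mem_repRing (G : Type) [Group G] [Fintype G] : 1 ∈ repRing G := by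
  convert character_mem_repRing (FDRep.of (Representation.trivial ℂ G ℂ))
  ext g
  change (1 : ℂ) = LinearMap.trace ℂ ℂ (Representation.trivial ℂ G ℂ g)
  have : Representation.trivial ℂ G ℂ g = 1 := by ext; simp
  rw [this, LinearMap.trace_one]
  simp

lemma aeval_mem_repRing {G : Type} [Group G] [Fintype G] {f : G → ℂ} (hf : f ∈ repRing G)
    (q : Polynomial ℤ) : Polynomial.aeval f q ∈ repRing G := by
  let R : Subalgebra ℤ (G → ℂ) :=
    (repRing G).toSubalgebra (one_mem_repRing G) fun _ _ => repRing_mul_mem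
  have hle : Algebra.adjoin ℤ {f} ≤ R := Algebra.adjoin_le (Set.singleton_subset_iff.2 hf)
  exact hle (Polynomial.aeval_mem_adjoin_singleton ℤ f)

lemma rho_pow_card {G : Type} [Group G] [Fintype G] (V : FDRep ℂ G) (g : G) :
    V.ρ g ^ Fintype.card G = 1 := by
  rw [← map_pow, pow_card_eq_one, map_one]

/-- The subring of `ℂ` generated by the `n`-th roots of unity. -/
noncomputable def rootsSubring (n : ℕ) : Subalgebra ℤ ℂ :=
  Algebra.adjoin ℤ {z : ℂ | z ^ n = 1}

lemma isIntegral_of_pow_eq_one {n : ℕ} (hn : n ≠ 0) {z : ℂ} (hz : z ^ n = 1) : IsIntegral ℤ z :=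
  IsIntegral.of_pow (Nat.pos_of_ne_zero hn) (hz ▸ isIntegral_one)

lemma rootsSubring_finite {n : ℕ} (hn : n ≠ 0) : Module.Finite ℤ (rootsSubring n) := by
  have hfin : {z : ℂ | z ^ n = 1}.Finite := by
    refine (Polynomial.nthRootsFinset n (1 : ℂ)).finite_toSet.subset fun z hz => ?_
    exact (Polynomial.mem_nthRootsFinset (Nat.pos_of_ne_zero hn) 1).2 hz
  exact Module.Finite.iff_fg.2
    (fg_adjoin_of_finite hfin fun z hz => isIntegral_of_pow_eq_one hn hz)

lemma character_mem_rootsSubring {G : Type} [Group G] [Fintype G] (V : FDRep ℂ G) (g : G) :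
    V.character g ∈ rootsSubring (Fintype.card G) := by
  change LinearMap.trace ℂ V (V.ρ g) ∈ _
  rw [trace_eq_sum_roots_charpoly]
  exact multiset_sum_mem _ fun z hz =>
    Algebra.subset_adjoin (pow_eq_one_of_mem_roots_charpoly (rho_pow_card V g) hz)

lemma isIntegral_character {G : Type} [Group G] [Fintype G] (V : FDRep ℂ G) (g : G) :
    IsIntegral ℤ (V.character g) := by
  have := rootsSubring_finite (Fintype.card_ne_zero (α := G))
  exact (Algebra.IsIntegral.isIntegral (R := ℤ)
    (⟨_, character_mem_rootsSubring V g⟩ : rootsSubring (Fintype.card G))).map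
    (rootsSubring (Fintype.card G)).val

instance isNoetherian_repRing (G : Type) [Group G] [Fintype G] : IsNoetherian ℤ (repRing G) := by
  have := rootsSubring_finite (Fintype.card_ne_zero (α := G))
  let L : (G → rootsSubring (Fintype.card G)) →ₗ[ℤ] (G → ℂ) :=
    (rootsSubring (Fintype.card G)).val.toLinearMap.compLeft G
  have hle : repRing G ≤ LinearMap.range L := by
    refine Submodule.span_le.2 ?_
    rintro _ ⟨V, rfl⟩
    exact ⟨fun g => ⟨_, character_mem_rootsSubring V g⟩, rfl⟩
  exact isNoetherian_of_le hle

lemma eq_one_of_finrank_le_re_character {G : Type} [Group G] [Fintype G] (V : FDRep ℂ G)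
    (hV : Function.Injective V.ρ) {g : G}
    (h : (Module.finrank ℂ V : ℝ) ≤ (V.character g).re) : g = 1 :=
  hV ((eq_one_of_finrank_le_re_trace Fintype.card_ne_zero (rho_pow_card V g) h).trans
    (map_one _).symm)

/-- An integer polynomial that vanishes at all values of a character other than `a`, but not
at `a`. -/
lemma exists_aeval_character_eq_zero {G : Type} [Group G] [Fintype G] (V : FDRep ℂ G) (a : ℤ) :
    ∃ q : Polynomial ℤ, q.eval a ≠ 0 ∧
      ∀ g, V.character g ≠ (a : ℂ) → Polynomial.aeval (V.character g) q = 0 := by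
  let p : Polynomial ℤ := ∏ g : G, minpoly ℤ (V.character g)
  have hp : p ≠ 0 := Finset.prod_ne_zero_iff.2 fun g _ =>
    (minpoly.monic (isIntegral_character V g)).ne_zero
  obtain ⟨q, hq, hdvd⟩ := p.exists_eq_pow_rootMultiplicity_mul_and_not_dvd hp a
  refine ⟨q, fun h => hdvd (Polynomial.dvd_iff_isRoot.2 h), fun g hg => ?_⟩
  have hpg : Polynomial.aeval (V.character g) p = 0 := by
    simp only [p, map_prod]
    exact Finset.prod_eq_zero (Finset.mem_univ g) (minpoly.aeval _ _)
  rw [hq, map_mul, map_pow] at hpg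
  refine (mul_eq_zero.1 hpg).resolve_left (pow_ne_zero _ ?_)
  simpa [sub_eq_zero] using hg

/-- The virtual characters supported on the set where `χ` takes the value `a`. -/
def eigenLattice (G : Type) [Group G] [Fintype G] (χ : G → ℂ) (a : ℤ) : Submodule ℤ (G → ℂ) where
  carrier := {f | f ∈ repRing G ∧ ∀ g, χ g ≠ a → f g = 0}
  zero_mem' := ⟨zero_mem _, fun _ _ => rfl⟩
  add_mem' := fun hf hh => ⟨add_mem hf.1 hh.1, fun g hg => by simp [hf.2 g hg, hh.2 g hg]⟩
  smul_mem' := fun n _ hf => ⟨Submodule.smul_mem _ n hf.1, fun g hg => by simp [hf.2 g hg]⟩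

lemma mem_eigenLattice {G : Type} [Group G] [Fintype G] {χ : G → ℂ} {a : ℤ} {f : G → ℂ} :
    f ∈ eigenLattice G χ a ↔ f ∈ repRing G ∧ ∀ g, χ g ≠ a → f g = 0 :=
  Iff.rfl

instance finite_eigenLattice (G : Type) [Group G] [Fintype G] (χ : G → ℂ) (a : ℤ) :
    Module.Finite ℤ (eigenLattice G χ a) :=
  have : IsNoetherian ℤ (eigenLattice G χ a) :=
    isNoetherian_of_le (fun _ hf => hf.1 : eigenLattice G χ a ≤ repRing G)
  inferInstance

lemma card_le_finrank_eigenLattice {G : Type} [Group G] [Fintype G] (V : FDRep ℂ G) (a : ℤ)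
    (S : Finset G) (hval : ∀ g ∈ S, V.character g = (a : ℂ))
    (hnonconj : ∀ g ∈ S, ∀ h ∈ S, g ≠ h → ¬ IsConj g h) :
    S.card ≤ Module.finrank ℤ (eigenLattice G V.character a) := by
  classical
  obtain ⟨q, hqa, hq⟩ := exists_aeval_character_eq_zero V a
  let b := Module.finBasis ℤ (eigenLattice G V.character a)
  let res : (G → ℂ) →ₗ[ℂ] (S → ℂ) := LinearMap.funLeft ℂ ℂ Subtype.val
  have hqV : Polynomial.aeval V.character q ∈ repRing G :=
    aeval_mem_repRing (character_mem_repRing V) q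
  have happ : ∀ g, Polynomial.aeval V.character q g = Polynomial.aeval (V.character g) q :=
    fun g => (Polynomial.aeval_algHom_apply (Pi.evalAlgHom ℤ (fun _ : G => ℂ) g)
      V.character q).symm
  let N : Submodule ℂ (S → ℂ) :=
    Submodule.span ℂ (Set.range fun i => res (b i))
  have hM : ∀ f ∈ eigenLattice G V.character a, res f ∈ N := by
    intro f hf
    have hsum := congrArg Subtype.val (b.sum_repr ⟨f, hf⟩)
    simp only [Submodule.coe_sum, Submodule.coe_smul] at hsum
    rw [← hsum, map_sum]
    refine Submodule.sum_mem _ fun i _ => ?_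
    rw [map_zsmul]
    exact zsmul_mem (Submodule.subset_span (Set.mem_range_self i)) _
  have hspan : ∀ f ∈ Submodule.span ℂ {f : G → ℂ | ∃ V : FDRep ℂ G, f = V.character},
      res (Polynomial.aeval V.character q * f) ∈ N := by
    intro f hf
    induction hf using Submodule.span_induction with
    | mem f hf =>
      obtain ⟨W, rfl⟩ := hf
      exact hM _ (mem_eigenLattice.2 ⟨repRing_mul_mem hqV (character_mem_repRing W),
        fun g hg => by rw [Pi.mul_apply, happ, hq g hg, zero_mul]⟩)
    | zero => simp
    | add f h _ _ hf hh => rw [mul_add, map_add]; exact add_mem hf hh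
    | smul c f _ hf => rw [mul_smul_comm, map_smul]; exact Submodule.smul_mem _ _ hf
  have htop : N = ⊤ := by
    rw [eq_top_iff, ← (Pi.basisFun ℂ S).span_eq, Submodule.span_le]
    rintro _ ⟨s, rfl⟩
    obtain ⟨f, hf, hfs⟩ := exists_mem_span_character_ne_zero_iff_isConj (s : G)
    have hfs0 : f s ≠ 0 := (hfs s).2 (IsConj.refl _)
    have hqa' : ((q.eval a : ℤ) : ℂ) ≠ 0 := Int.cast_ne_zero.2 hqa
    have haeval : ∀ t : S, Polynomial.aeval V.character q t = ((q.eval a : ℤ) : ℂ) := fun t => by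
      rw [happ, hval t t.2]
      simpa using Polynomial.aeval_algebraMap_apply ℂ a q
    have heq : Pi.basisFun ℂ S s =
        (((q.eval a : ℤ) : ℂ) * f s)⁻¹ • res (Polynomial.aeval V.character q * f) := by
      ext t
      have h2 : res (Polynomial.aeval V.character q * f) t = ((q.eval a : ℤ) : ℂ) * f t := by
        rw [← haeval t]; rfl
      rw [Pi.smul_apply, h2, Pi.basisFun_apply, smul_eq_mul]
      by_cases hts : t = s
      · subst hts
        rw [Pi.single_eq_same, inv_mul_cancel₀ (mul_ne_zero hqa' hfs0)]
      · have : f t = 0 := by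
          by_contra h
          exact hnonconj s s.2 t t.2 (fun h => hts (Subtype.ext h.symm)) ((hfs t).1 h)
        rw [Pi.single_eq_of_ne hts, this, mul_zero, mul_zero]
    rw [heq]
    exact Submodule.smul_mem _ _ (hspan f hf)
  have hcard := finrank_range_le_card (R := ℂ) fun i => res (b i)
  rw [Set.finrank] at hcard
  change Module.finrank ℂ N ≤ _ at hcard
  rw [htop, finrank_top] at hcard
  simpa using hcard

/-- If `a < dim V`, the critical group contains `(ℤ/(dim V - a))^k` for every `k` up to the rank of
the lattice of virtual characters supported where the character of `V` equals `a`. -/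
lemma exists_injective_of_le_finrank {G : Type} [Group G] [Fintype G]
    (V : FDRep ℂ G) (hV : Function.Injective V.ρ) (a : ℤ)
    (hd : 0 < (Module.finrank ℂ V : ℤ) - a) {k : ℕ}
    (hk : k ≤ Module.finrank ℤ (eigenLattice G V.character a)) :
    ∃ φ : (Fin k → ZMod ((Module.finrank ℂ V - a).toNat)) →+ Kgroup G V.character,
      Function.Injective φ := by
  obtain ⟨d, hdd⟩ : ∃ d : ℕ, (Module.finrank ℂ V : ℤ) - a = d :=
    ⟨_, (Int.toNat_of_nonneg hd.le).symm⟩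
  have hdC : V.character 1 - a = d := by
    rw [FDRep.char_one]; exact_mod_cast hdd
  have hd0 : (d : ℂ) ≠ 0 := by
    have : (d : ℤ) ≠ 0 := hdd ▸ hd.ne'
    exact_mod_cast this
  have h1a : V.character 1 ≠ a := fun h => hd0 (by rw [← hdC, h, sub_self])
  rw [hdd, Int.toNat_natCast]
  have hle : eigenLattice G V.character a ≤ R0 G := fun f hf => ⟨hf.1, hf.2 1 h1a⟩
  have hmul : ∀ f ∈ eigenLattice G V.character a, cfun G V.character * f = (d : ℤ) • f := by
    intro f hf
    ext g
    by_cases hg : V.character g = a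
    · change (V.character 1 - V.character g) * f g = ((d : ℤ) • f) g
      rw [hg, hdC]
      simp
    · simp [hf.2 g hg]
  have hback : ∀ f ∈ R0 G, cfun G V.character * f ∈ eigenLattice G V.character a →
      f ∈ eigenLattice G V.character a := by
    refine fun f hf hcf => ⟨hf.1, fun g hg => ?_⟩
    by_cases hg1 : g = 1
    · rw [hg1]; exact hf.2
    · refine (mul_eq_zero.1 (hcf.2 g hg)).resolve_left fun h => hg1 ?_
      refine eq_one_of_finrank_le_re_character V hV ?_
      rw [← sub_eq_zero.1 h, FDRep.char_one, Complex.natCast_re]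
  let b := Module.finBasis ℤ (eigenLattice G V.character a)
  let e : Fin k → Fin (Module.finrank ℤ (eigenLattice G V.character a)) := Fin.castLE hk
  let F₀ : (Fin k → ℤ) →ₗ[ℤ] eigenLattice G V.character a := Fintype.linearCombination ℤ (b ∘ e)
  let F : (Fin k → ℤ) →ₗ[ℤ] Kgroup G V.character :=
    (critIm G V.character).mkQ ∘ₗ Submodule.inclusion hle ∘ₗ F₀
  have hF : ∀ v, F v = 0 ↔ ∀ i, (d : ℤ) ∣ v i := by
    intro v
    have hiff : F v = 0 ↔ ∃ f ∈ R0 G, cfun G V.character * f = F₀ v :=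
      Submodule.Quotient.mk_eq_zero (critIm G V.character)
    rw [hiff]
    constructor
    · rintro ⟨f, hf, hfv⟩ i
      have hfM := hback f hf (hfv ▸ (F₀ v).2)
      have hval : F₀ v = (d : ℤ) • (⟨f, hfM⟩ : eigenLattice G V.character a) :=
        Subtype.ext (by rw [← hfv, hmul f hfM]; rfl)
      have hrepr : b.repr (F₀ v) (e i) = v i := by
        simp [F₀, Fintype.linearCombination_apply, Finsupp.single_apply, e]
      rw [← hrepr, hval, map_smul]
      exact ⟨_, rfl⟩
    · intro h
      choose w hw using h
      refine ⟨F₀ w, hle (F₀ w).2, ?_⟩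
      have hv : v = (d : ℤ) • w := funext hw
      rw [hmul _ (F₀ w).2, hv, map_smul]
      rfl
  let π : (Fin k → ℤ) →+ (Fin k → ZMod d) := (Int.castAddHom (ZMod d)).compLeft (Fin k)
  have hπ : Function.Surjective π := fun v =>
    ⟨fun i => (ZMod.intCast_surjective (v i)).choose,
      funext fun i => (ZMod.intCast_surjective (v i)).choose_spec⟩
  have hπ0 : ∀ v, π v = 0 ↔ F v = 0 := by
    intro v
    rw [hF, funext_iff]
    exact forall_congr' fun i => ZMod.intCast_zmod_eq_zero_iff_dvd (v i) d
  refine ⟨π.liftOfSurjective hπ ⟨F.toAddMonoidHom, fun v hv => (hπ0 v).1 hv⟩, ?_⟩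
  rw [injective_iff_map_eq_zero]
  intro x hx
  obtain ⟨v, rfl⟩ := hπ x
  rw [hπ0]
  rwa [AddMonoidHom.liftOfRightInverse_comp_apply] at hx

/-- Theorem 3(b) of [G1].  Let `V` be a faithful finite-dimensional
complex representation of a finite group `G`, and suppose the integer `a` is a value of
`χ_V` achieved on exactly the `m` different conjugacy classes of the elements of `S`
(`S` a set of `m` pairwise non-conjugate elements on which `χ_V = a`, meeting every
class on which `χ_V` takes the value `a`).  Then `K(V)` contains a subgroup isomorphic
to `(ℤ/(dim V − a)ℤ)^{m−1}`. -/
theorem stmt3 (G : Type) [Group G] [Fintype G]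
    (V : FDRep ℂ G) (hfaithful : Function.Injective V.ρ)
    (a : ℤ) (m : ℕ) (S : Finset G) (hcard : S.card = m)
    (hval : ∀ g ∈ S, V.character g = (a : ℂ))
    (hnonconj : ∀ g ∈ S, ∀ h ∈ S, g ≠ h → ¬ IsConj g h)
    (hall : ∀ g : G, V.character g = (a : ℂ) → ∃ c ∈ S, IsConj c g) :
    ∃ φ : (Fin (m - 1) → ZMod ((Module.finrank ℂ V - a).toNat)) →+ Kgroup G V.character,
      Function.Injective φ := by
  rcases le_or_gt (Module.finrank ℂ V - a) 0 with hd | hd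
  · have hS : S ⊆ {1} := fun g hg => by
      refine Finset.mem_singleton.2 (eq_one_of_finrank_le_re_character V hfaithful ?_)
      rw [hval g hg, Complex.intCast_re]
      exact_mod_cast sub_nonpos.1 hd
    have hm : m - 1 = 0 := by
      have := Finset.card_le_card hS
      rw [Finset.card_singleton] at this
      omega
    have : IsEmpty (Fin (m - 1)) := by rw [hm]; infer_instance
    exact ⟨0, Function.injective_of_subsingleton _⟩
  · obtain ⟨φ, hφ⟩ := exists_injective_of_le_finrank V hfaithful a hd (k := m - 1) (by
      have := card_le_finrank_eigenLattice V a S hval hnonconj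
      omega)
    exact ⟨φ, hφ⟩
end

section
/- Let σ : H → G be an injective homomorphism of finite groups and V a faithful finite-dimensional complex representation of G. For a representation W of G let W^σ denote the representation of H with h·w := σ(h)w. Then V^σ is a faithful representation of H, and the assignment [W] ↦ [W^σ] induces a well-defined group homomorphism \bar{σ} : K(V) → K(V^σ). If σ is an isomorphism, then \bar{σ} is an isomorphism of groups. -/
/- The representation ring `R(G)` of a finite group `G` is modeled as the ring of virtual
characters: the ℤ-span of the characters of finite-dimensional complex representations,
inside the ring `G → ℂ` (a faithful model in characteristic zero).  Under this
identification, multiplication by the class of a representation is pointwise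
multiplication by its character, the dimension homomorphism is evaluation at `1`, and
restriction of representations is precomposition of characters. -/

open CategoryTheory

theorem comp_mem_repRing {G H : Type} [Group G] [Fintype G] [Group H] [Fintype H]
    (σ : H →* G) {f : G → ℂ} (hf : f ∈ repRing G) : f ∘ σ ∈ repRing H := by
  suffices h : repRing G ≤ (repRing H).comap (LinearMap.funLeft ℤ ℂ σ) from h hf
  refine Submodule.span_le.2 ?_
  rintro _ ⟨W, rfl⟩
  exact Submodule.subset_span ⟨FDRep.of (W.ρ.comp σ), rfl⟩

theorem mem_R0 {G : Type} [Group G] [Fintype G] {f : G → ℂ} :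
    f ∈ R0 G ↔ f ∈ repRing G ∧ f 1 = 0 :=
  Iff.rfl

theorem comp_mem_R0 {G H : Type} [Group G] [Fintype G] [Group H] [Fintype H]
    (σ : H →* G) {f : G → ℂ} (hf : f ∈ R0 G) : f ∘ σ ∈ R0 H := by
  rw [mem_R0] at hf ⊢
  exact ⟨comp_mem_repRing σ hf.1, by simpa using hf.2⟩

theorem mem_critIm {G : Type} [Group G] [Fintype G] {χ : G → ℂ} {x : R0 G} :
    x ∈ critIm G χ ↔ ∃ z ∈ R0 G, cfun G χ * z = x :=
  Iff.rfl

theorem cfun_comp {G H : Type} [Group G] [Fintype G] [Group H] [Fintype H]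
    (σ : H →* G) (χ : G → ℂ) : cfun H (χ ∘ σ) = cfun G χ ∘ σ := by
  ext h
  simp [cfun]

/-- Restriction of virtual characters of virtual dimension `0` along `σ`. -/
noncomputable def R0.res {G H : Type} [Group G] [Fintype G] [Group H] [Fintype H]
    (σ : H →* G) : R0 G →ₗ[ℤ] R0 H :=
  (LinearMap.funLeft ℤ ℂ σ).restrict fun _ hf => comp_mem_R0 σ hf

theorem R0.coe_res {G H : Type} [Group G] [Fintype G] [Group H] [Fintype H]
    (σ : H →* G) (x : R0 G) : (R0.res σ x : H → ℂ) = (x : G → ℂ) ∘ σ :=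
  rfl

theorem critIm_le_comap_res {G H : Type} [Group G] [Fintype G] [Group H] [Fintype H]
    (σ : H →* G) (χ : G → ℂ) :
    critIm G χ ≤ (critIm H (χ ∘ σ)).comap (R0.res σ) := by
  intro x hx
  obtain ⟨z, hz, hzx⟩ := mem_critIm.1 hx
  refine mem_critIm.2 ⟨z ∘ σ, comp_mem_R0 σ hz, ?_⟩
  rw [cfun_comp, R0.coe_res, ← hzx]
  rfl

/-- The map `K(V) → K(V^σ)` induced by restriction along `σ`. -/
noncomputable def Kgroup.res {G H : Type} [Group G] [Fintype G] [Group H] [Fintype H]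
    (σ : H →* G) (χ : G → ℂ) : Kgroup G χ →ₗ[ℤ] Kgroup H (χ ∘ σ) :=
  Submodule.mapQ _ _ (R0.res σ) (critIm_le_comap_res σ χ)

theorem Kgroup.bijective_res {G H : Type} [Group G] [Fintype G] [Group H] [Fintype H]
    (e : H ≃* G) (χ : G → ℂ) : Function.Bijective (Kgroup.res e.toMonoidHom χ) := by
  constructor
  · rw [injective_iff_map_eq_zero]
    intro a ha
    obtain ⟨x, rfl⟩ := Submodule.Quotient.mk_surjective _ a
    obtain ⟨z, hz, hzx⟩ := mem_critIm.1 ((Submodule.Quotient.mk_eq_zero _).1 ha)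
    refine (Submodule.Quotient.mk_eq_zero _).2
      (mem_critIm.2 ⟨z ∘ e.symm, comp_mem_R0 e.symm.toMonoidHom hz, ?_⟩)
    ext g
    simpa [cfun, R0.coe_res] using congrFun hzx (e.symm g)
  · intro b
    obtain ⟨y, rfl⟩ := Submodule.Quotient.mk_surjective _ b
    refine ⟨Submodule.Quotient.mk (R0.res e.symm.toMonoidHom y),
      congrArg Submodule.Quotient.mk (Subtype.ext ?_)⟩
    ext h
    simp [R0.coe_res]

/-- Theorem 3.1 of the paper.  Let `σ : H → G` be an injective
homomorphism of finite groups and `V` a faithful finite-dimensional complex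
representation of `G`.  The twisted representation `V^σ` has character `χ_V ∘ σ`; it is
faithful, and `[W] ↦ [W^σ]` (which on characters is `f ↦ f ∘ σ`) induces a well-defined
group homomorphism `σ̄ : K(V) → K(V^σ)`, which is an isomorphism when `σ` is. -/
theorem stmt4 (G H : Type) [Group G] [Fintype G] [Group H] [Fintype H]
    (σ : H →* G) (hσ : Function.Injective σ)
    (V : FDRep ℂ G) (hfaithful : Function.Injective V.ρ) :
    -- `V^σ` is a faithful representation of `H`
    (Function.Injective fun h : H => V.ρ (σ h)) ∧
    -- `[W] ↦ [W^σ]` induces a well-defined group homomorphism `K(V) → K(V^σ)`,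
    -- which is an isomorphism whenever `σ` is
    (∃ φ : Kgroup G V.character →+ Kgroup H (V.character ∘ σ),
      (∀ (x : R0 G) (y : R0 H), (y : H → ℂ) = (x : G → ℂ) ∘ σ →
          φ (Submodule.Quotient.mk x) = Submodule.Quotient.mk y) ∧
      (Function.Bijective σ → Function.Bijective φ)) := by
  refine ⟨hfaithful.comp hσ, (Kgroup.res σ V.character).toAddMonoidHom, ?_, ?_⟩
  · intro x y hxy
    exact congrArg Submodule.Quotient.mk (Subtype.ext hxy.symm)
  · intro hb
    exact Kgroup.bijective_res (MulEquiv.ofBijective σ hb) V.character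
end

section
/- Let 𝔊 : {e} = G_0 ⊆ G_1 ⊆ G_2 ⊆ ⋯ be an r-differential tower of groups. Then |G_n| = r^n · n! for all n ≥ 0. -/
/- The representation ring `R(G)` of a finite group `G` is modeled as the ring of virtual
characters: the ℤ-span of the characters of finite-dimensional complex representations,
inside the ring `G → ℂ` (a faithful model in characteristic zero).  Under this
identification, multiplication by the class of a representation is pointwise
multiplication by its character, the dimension homomorphism is evaluation at `1`,
restriction of representations is precomposition of characters, and induction is given
by the induced-character formula.  A tower of groups `G 0 ⊆ G 1 ⊆ ⋯` is modeled by a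
sequence of finite groups with injective homomorphisms `f n : G n →* G (n+1)`, and the
induction and restriction operators act on the graded space `∀ n, (G n → ℂ)`, with
restriction acting as `0` on the bottom rank. -/

open CategoryTheory

/-- the character inner product, which makes the irreducible characters orthonormal. -/
noncomputable def cinner (G : Type) [Group G] [Fintype G] (a b : G → ℂ) : ℂ :=
  (Fintype.card G : ℂ)⁻¹ * ∑ g : G, a g * (starRingEnd ℂ) (b g)

open Classical in
/-- the induced character along an (injective) homomorphism `φ : K →* L`:
`(Ind x)(g) = |K|⁻¹ ∑_{y ∈ L} ẋ(y⁻¹ g y)`, where `ẋ` is `x` transported to the image of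
`φ` and extended by zero.  It is presented as multiplication by a matrix, so that
linearity is automatic. -/
noncomputable def indMat {K L : Type} [Group K] [Fintype K] [Group L] [Fintype L]
    (φ : K →* L) : Matrix L K ℂ :=
  fun g k => (Fintype.card K : ℂ)⁻¹ * ∑ y : L, if φ k = y⁻¹ * g * y then 1 else 0

/-- the graded induction operator on `⨁ₙ R(G n)` (extended to all functions):
`(Ind x) (n+1) = Ind^{G (n+1)}_{G n} (x n)`, and `(Ind x) 0 = 0`. -/
noncomputable def IndOp (G : ℕ → Type) [∀ n, Group (G n)] [∀ n, Fintype (G n)]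
    (f : ∀ n, G n →* G (n + 1)) : (∀ n, G n → ℂ) →ₗ[ℂ] (∀ n, G n → ℂ) where
  toFun x n := match n with
    | 0 => 0
    | (m + 1) => (indMat (f m)).mulVecLin (x m)
  map_add' x y := by
    funext n
    cases n with
    | zero => show (0 : G 0 → ℂ) = 0 + 0; simp
    | succ m => exact map_add _ _ _
  map_smul' c x := by
    funext n
    cases n with
    | zero => show (0 : G 0 → ℂ) = c • 0; simp
    | succ m => exact map_smul _ c _

/-- the graded restriction operator on `⨁ₙ R(G n)` (extended to all functions):
`(Res x) n = Res^{G (n+1)}_{G n} (x (n+1))`, i.e. restriction is precomposition of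
characters; the rank-`0` component of `x` is sent to `0` (the convention
`Res [V] = 0` for `[V] ∈ R(G 0)`). -/
noncomputable def ResOp (G : ℕ → Type) [∀ n, Group (G n)] [∀ n, Fintype (G n)]
    (f : ∀ n, G n →* G (n + 1)) : (∀ n, G n → ℂ) →ₗ[ℂ] (∀ n, G n → ℂ) where
  toFun x n := fun g => x (n + 1) (f n g)
  map_add' x y := rfl
  map_smul' c x := rfl

/-- a word in the letters `U` (`true`) and `D` (`false`) is balanced when it has as many
`U`'s as `D`'s. -/
def BalancedWord (w : List Bool) : Prop := w.count true = w.count false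

/-- the operator `w(Ind, Res)` on the graded space `⨁ₙ R(G n)`: the letters of `w` are
applied right to left, with `U ↦ Ind` and `D ↦ Res`. -/
noncomputable def wordOpRep (G : ℕ → Type) [∀ n, Group (G n)] [∀ n, Fintype (G n)]
    (f : ∀ n, G n →* G (n + 1)) (w : List Bool) :
    (∀ n, G n → ℂ) →ₗ[ℂ] (∀ n, G n → ℂ) :=
  w.foldr (fun b acc => (if b then IndOp G f else ResOp G f) ∘ₗ acc) LinearMap.id

/-- (DTG1): branching from `G (n+1)` to `G n` is multiplicity-free: for irreducible
(simple) `X`, `Y`, the multiplicity `⟨Res χ_X, χ_Y⟩` is `0` or `1`. -/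
def DTG1 (G : ℕ → Type) [∀ n, Group (G n)] [∀ n, Fintype (G n)]
    (f : ∀ n, G n →* G (n + 1)) : Prop :=
  ∀ n (X : FDRep ℂ (G (n + 1))) (Y : FDRep ℂ (G n)), Simple X → Simple Y →
    cinner (G n) (fun g => X.character (f n g)) Y.character ∈ ({0, 1} : Set ℂ)

/-- (DTG2): `Res ∘ Ind − Ind ∘ Res = r · id` as operators on each `R(G n)` (with the
convention that `Res = 0` on `R(G 0)`); an element `x ∈ R(G n)` is represented as the
graded vector `X` concentrated in rank `n` with value `x`. -/
def DTG2 (r : ℕ) (G : ℕ → Type) [∀ n, Group (G n)] [∀ n, Fintype (G n)]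
    (f : ∀ n, G n →* G (n + 1)) : Prop :=
  ∀ n, ∀ x ∈ repRing (G n), ∀ X : ∀ m, G m → ℂ,
    (X n = x ∧ ∀ m, m ≠ n → X m = 0) →
      ResOp G f (IndOp G f X) n - IndOp G f (ResOp G f X) n = (r : ℂ) • x

open Classical in
theorem indMat_mulVec_one {K L : Type} [Group K] [Fintype K] [Group L] [Fintype L]
    (φ : K →* L) (hφ : Function.Injective φ) (x : K → ℂ) :
    (indMat φ).mulVec x 1 = (Fintype.card K : ℂ)⁻¹ * Fintype.card L * x 1 := by
  rw [Matrix.mulVec, dotProduct, Finset.sum_eq_single (1 : K)]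
  · simp [indMat]
  · intro k _ hk
    have h : φ k ≠ 1 := fun h => hk (hφ (h.trans (map_one φ).symm))
    simp [indMat, h]
  · simp

theorem exists_mem_repRing_one_eq_one (G : Type) [Group G] [Fintype G] :
    ∃ x ∈ repRing G, x 1 = 1 :=
  ⟨_, Submodule.subset_span ⟨FDRep.of (Representation.trivial ℂ G ℂ), rfl⟩, by
    rw [FDRep.char_one]
    exact_mod_cast Module.finrank_self ℂ⟩

theorem DTG2.index_succ {r : ℕ} {G : ℕ → Type} [∀ n, Group (G n)] [∀ n, Fintype (G n)]
    {f : ∀ n, G n →* G (n + 1)} (hinj : ∀ n, Function.Injective (f n))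
    (h : DTG2 r G f) (n : ℕ) :
    (Fintype.card (G n) : ℂ)⁻¹ * Fintype.card (G (n + 1)) = (n + 1) * r := by
  induction n with
  | zero =>
    obtain ⟨x, hx, hx1⟩ := exists_mem_repRing_one_eq_one (G 0)
    have key := congrFun (h 0 x hx (Pi.single 0 x)
      ⟨Pi.single_eq_same _ _, fun m hm => Pi.single_eq_of_ne hm _⟩) 1
    simpa [ResOp, IndOp, indMat_mulVec_one _ (hinj _), hx1] using key
  | succ n ih =>
    obtain ⟨x, hx, hx1⟩ := exists_mem_repRing_one_eq_one (G (n + 1))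
    have key := congrFun (h (n + 1) x hx (Pi.single (n + 1) x)
      ⟨Pi.single_eq_same _ _, fun m hm => Pi.single_eq_of_ne hm _⟩) 1
    simp only [ResOp, IndOp, LinearMap.coe_mk, AddHom.coe_mk, Pi.sub_apply, Pi.smul_apply,
      Matrix.mulVecLin_apply, map_one, indMat_mulVec_one _ (hinj _), Pi.single_eq_same, hx1,
      mul_one, ih, smul_eq_mul] at key
    push_cast
    linear_combination key

/-- Proposition 2.16 of the paper.  If
`{e} = G 0 ⊆ G 1 ⊆ G 2 ⊆ ⋯` is an `r`-differential tower of groups, then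
`|G n| = rⁿ · n!` for all `n ≥ 0`. -/
theorem stmt8 (r : ℕ) (hr : 0 < r)
    (G : ℕ → Type) [∀ n, Group (G n)] [∀ n, Fintype (G n)]
    (f : ∀ n, G n →* G (n + 1)) (hinj : ∀ n, Function.Injective (f n))
    (htriv : Fintype.card (G 0) = 1)
    (h1 : DTG1 G f) (h2 : DTG2 r G f) :
    ∀ n, Fintype.card (G n) = r ^ n * n.factorial := by
  intro n
  induction n with
  | zero => simpa using htriv
  | succ n ih =>
    have h := h2.index_succ hinj n
    have hne : (Fintype.card (G n) : ℂ) ≠ 0 := Nat.cast_ne_zero.mpr Fintype.card_ne_zero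
    rw [inv_mul_eq_iff_eq_mul₀ hne, ih] at h
    have h' : Fintype.card (G (n + 1)) = r ^ n * n.factorial * ((n + 1) * r) := by
      exact_mod_cast h
    rw [h', Nat.factorial_succ]
    ring
end

section
/- Let 𝔊 : {e} = G_0 ⊆ G_1 ⊆ ⋯ be an r-differential tower of groups, and let f = Σ_i c_i w^{(i)} be a finite sum of balanced words in the letters U, D with nonnegative integer coefficients c_i. Let f(Ind, Res) denote the operator on R(G_n) obtained by replacing each U by induction and each D by restriction between consecutive groups of the tower, and set V(f)_n := f(Ind, Res)[1_{G_n}]. Then multiplication by [V(f)_n] in R(G_n) equals the operator f(Ind, Res) : R(G_n) → R(G_n), and the multiset of character values of V(f)_n equals the multiset of eigenvalues of the operator f(Ind, Res) on R(G_n) ⊗ ℂ. -/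
/- The representation ring `R(G)` of a finite group `G` is modeled as the ring of virtual
characters: the ℤ-span of the characters of finite-dimensional complex representations,
inside the ring `G → ℂ` (a faithful model in characteristic zero).  Under this
identification, multiplication by the class of a representation is pointwise
multiplication by its character, the dimension homomorphism is evaluation at `1`,
restriction of representations is precomposition of characters, and induction is given
by the induced-character formula.  A tower of groups `G 0 ⊆ G 1 ⊆ ⋯` is modeled by a
sequence of finite groups with injective homomorphisms `f n : G n →* G (n+1)`, and the
induction and restriction operators act on the graded space `∀ n, (G n → ℂ)`, with
restriction acting as `0` on the bottom rank. -/

open CategoryTheory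

section ClassFunctions

open Representation MonoidAlgebra

/-- By Schur's lemma, an element of the group algebra whose coefficients form a class function
orthogonal to the character of an irreducible representation acts on it by zero. -/
theorem sum_smul_eq_zero_of_isIrreducible {G V : Type*} [Group G] [Fintype G] [AddCommGroup V]
    [Module ℂ V] [FiniteDimensional ℂ V] (ρ : Representation ℂ G V) [Representation.IsIrreducible ρ]
    (ψ : G → ℂ) (hψ : ∀ g h, ψ (h * g * h⁻¹) = ψ g)
    (h0 : ∑ g, ψ g * ρ.character g = 0) :
    ∑ g, ψ g • ρ g = 0 := by
  set T : V →ₗ[ℂ] V := ∑ g, ψ g • ρ g with hT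
  have hcomm : ∀ h v, T (ρ h v) = ρ h (T v) := by
    intro h v
    simp only [hT, LinearMap.sum_apply, LinearMap.smul_apply, map_sum, map_smul]
    refine Fintype.sum_equiv (MulAut.conj h⁻¹).toEquiv _ _ fun g => ?_
    simp [← hψ g h⁻¹, ← Module.End.mul_apply, ← map_mul, mul_assoc]
  obtain ⟨t, ht⟩ := (IsIrreducible.algebraMap_intertwiningMap_bijective_of_isAlgClosed
    (ρ := ρ)).2 ⟨T, fun h => LinearMap.ext fun v => hcomm h v⟩
  have hTt : T = t • LinearMap.id := by
    ext v
    have := congrArg (fun f : IntertwiningMap ρ ρ => f v) ht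
    simpa using this.symm
  have htr : LinearMap.trace ℂ V T = 0 := by
    simpa [hT, Representation.character] using h0
  have hV : (Module.finrank ℂ V : ℂ) ≠ 0 := by
    have : IsSimpleModule (MonoidAlgebra ℂ G) ρ.asModule := inferInstance
    have hnt : Nontrivial V := IsSimpleModule.nontrivial (MonoidAlgebra ℂ G) ρ.asModule
    exact_mod_cast Module.finrank_pos.ne'
  rw [hTt] at htr
  have : t = 0 := by simpa [hV] using htr
  rw [hTt, this, zero_smul]

/-- A class function orthogonal to the characters of all simple representations vanishes. -/
theorem eq_zero_of_orthogonal_simple {G : Type} [Group G] [Fintype G]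
    (ψ : G → ℂ) (hψ : ∀ g h, ψ (h * g * h⁻¹) = ψ g)
    (h0 : ∀ V : FDRep ℂ G, Simple V → ∑ g, ψ g * V.character g = 0) : ψ = 0 := by
  have : Invertible (Nat.card G : ℂ) := invertibleOfNonzero (by simp)
  set z : MonoidAlgebra ℂ G := ∑ g, MonoidAlgebra.single g (ψ g) with hz
  have hsimple : ∀ S : Submodule (MonoidAlgebra ℂ G) (MonoidAlgebra ℂ G),
      IsSimpleModule (MonoidAlgebra ℂ G) S → ∀ m ∈ S, z * m = 0 := by
    intro S hS m hm
    let ρ : Representation ℂ G S := ofModule' S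
    have hρ : ∀ (a : MonoidAlgebra ℂ G) (v : S), ρ.asAlgebraHom a v = a • v := fun a v => by
      simp [ρ, asAlgebraHom, ofModule']
    let e : ρ.asModule ≃ₗ[MonoidAlgebra ℂ G] S :=
      { ρ.asModuleEquiv with
        map_smul' := fun a v => by
          rw [← hρ]
          exact ρ.asModuleEquiv_map_smul a v }
    have hirr : Representation.IsIrreducible ρ :=
      (irreducible_iff_isSimpleModule_asModule ρ).2 (IsSimpleModule.congr e)
    have hfin : FiniteDimensional ℂ (MonoidAlgebra ℂ G) := inferInstance
    have hfinS : FiniteDimensional ℂ S :=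
      .of_injective (S.subtype.restrictScalars ℂ) S.injective_subtype
    have hs : Simple (FDRep.of ρ) := by
      rw [FDRep.simple_iff_char_is_norm_one]
      have := char_orthonormal ρ ρ
      rw [if_pos ⟨Representation.Equiv.refl ρ⟩, inv_mul_eq_one₀ (by simp)] at this
      exact this.symm
    have hsum := sum_smul_eq_zero_of_isIrreducible ρ ψ hψ (h0 _ hs)
    have hz' : ρ.asAlgebraHom z = 0 := by
      rw [hz, map_sum, ← hsum]
      simp [asAlgebraHom_single]
    have := hρ z ⟨m, hm⟩
    rw [hz'] at this
    exact congrArg Subtype.val this.symm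
  have hall : ∀ m : MonoidAlgebra ℂ G, z * m = 0 := by
    intro m
    have hm : m ∈ sSup {S : Submodule (MonoidAlgebra ℂ G) (MonoidAlgebra ℂ G) |
        IsSimpleModule (MonoidAlgebra ℂ G) S} := by
      rw [IsSemisimpleModule.sSup_simples_eq_top]; trivial
    rw [sSup_eq_iSup'] at hm
    induction hm using Submodule.iSup_induction' with
    | mem S x hx => exact hsimple S S.2 x hx
    | zero => simp
    | add x y _ _ hx hy => rw [mul_add, hx, hy, add_zero]
  have hz0 : z = 0 := by simpa using hall 1
  funext g
  have := congrArg (fun x : MonoidAlgebra ℂ G => x.coeff g) hz0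
  classical
  simpa [hz, Finsupp.single_apply] using this

/-- The algebra of complex class functions on a group. -/
def classFunctions (G : Type*) [Group G] : Subalgebra ℂ (G → ℂ) where
  carrier := {x | ∀ g h, x (h * g * h⁻¹) = x g}
  add_mem' hx hy g h := by simp [hx g h, hy g h]
  mul_mem' hx hy g h := by simp [hx g h, hy g h]
  algebraMap_mem' _ _ _ := rfl

theorem apply_eq_of_isConj {G : Type*} [Group G] {x : G → ℂ} (hx : x ∈ classFunctions G) {g h : G}
    (hgh : IsConj g h) : x g = x h := by
  obtain ⟨k, rfl⟩ := isConj_iff.1 hgh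
  exact (hx g k).symm

/-- The characters of the simple representations span the space of class functions. -/
theorem classFunctions_le_span {G : Type} [Group G] [Fintype G] (s : Set (G → ℂ))
    (hs : ∀ V : FDRep ℂ G, Simple V → V.character ∈ s) :
    Subalgebra.toSubmodule (classFunctions G) ≤ Submodule.span ℂ s := by
  classical
  intro x hx
  by_contra hxs
  obtain ⟨L, hLs, hL⟩ := Submodule.exists_le_ker_of_notMem hxs
  set μ : G → ℂ := fun g => L (Pi.single g 1)
  have hLμ : ∀ y : G → ℂ, L y = ∑ g, μ g * y g := by
    intro y
    conv_lhs => rw [← Finset.univ_sum_single y, map_sum]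
    refine Finset.sum_congr rfl fun g _ => ?_
    have : Pi.single g (y g) = y g • (Pi.single g 1 : G → ℂ) := by
      rw [← Pi.single_smul, smul_eq_mul, mul_one]
    rw [this, map_smul, smul_eq_mul, mul_comm]
  set ψ : G → ℂ := fun g => ∑ h, μ (h * g * h⁻¹) with hψ
  have hψL : ∀ y ∈ classFunctions G, ∑ g, ψ g * y g = Fintype.card G * L y := by
    intro y hy
    simp only [hψ, Finset.sum_mul]
    rw [Finset.sum_comm, ← nsmul_eq_mul, ← Finset.card_univ, ← Finset.sum_const]
    refine Finset.sum_congr rfl fun h _ => ?_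
    rw [hLμ]
    refine Fintype.sum_equiv (MulAut.conj h).toEquiv _ _ fun g => ?_
    simp [hy g h]
  have hψ0 : ψ = 0 := by
    refine eq_zero_of_orthogonal_simple ψ (fun g h => ?_) fun V hV => ?_
    · refine Fintype.sum_equiv (Equiv.mulRight h) _ _ fun k => ?_
      simp [mul_assoc]
    · rw [hψL _ fun g h => V.char_conj g h,
        LinearMap.mem_ker.1 (hL (Submodule.subset_span (hs V hV))), mul_zero]
  have := hψL x hx
  rw [hψ0] at this
  simp at this
  exact hLs this

end ClassFunctions

section Words

variable {R A : Type*} [CommRing R] [Ring A] [Algebra R A]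

theorem mul_pow_succ_of_mul_eq {u d : A} {c : R} (h : d * u = u * d + c • 1) (i : ℕ) :
    d * u ^ (i + 1) = u ^ (i + 1) * d + ((i + 1 : ℕ) * c) • u ^ i := by
  induction i with
  | zero => simpa using h
  | succ i ih =>
    rw [pow_succ u (i + 1), ← mul_assoc, ih, add_mul, mul_assoc, h, smul_mul_assoc, ← pow_succ,
      mul_add, mul_smul_comm, mul_one, ← mul_assoc, ← pow_succ, add_assoc, ← add_smul]
    congr 2
    push_cast
    ring

/-- Normal ordering: if `d * u - u * d` is a scalar, every word in `u` and `d` is a linear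
combination of monomials `u ^ i * d ^ j` of the same degree. -/
theorem prod_word_mem_span {u d : A} {c : R} (h : d * u = u * d + c • 1) (w : List Bool) :
    (w.map fun b => if b then u else d).prod ∈ Submodule.span R
      {a : A | ∃ i j, i + w.count false = j + w.count true ∧ a = u ^ i * d ^ j} := by
  induction w with
  | nil => exact Submodule.subset_span ⟨0, 0, by simp⟩
  | cons b w ih =>
    rw [List.map_cons, List.prod_cons]
    generalize (w.map fun b => if b then u else d).prod = p at ih
    induction ih using Submodule.span_induction with
    | zero => simp
    | add x y _ _ hx hy => rw [mul_add]; exact add_mem hx hy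
    | smul t x _ hx => rw [mul_smul_comm]; exact Submodule.smul_mem _ t hx
    | mem x hx =>
      obtain ⟨i, j, hij, rfl⟩ := hx
      cases b with
      | true =>
        refine Submodule.subset_span ⟨i + 1, j, ?_, ?_⟩
        · simp; omega
        · simp [pow_succ', mul_assoc]
      | false =>
        cases i with
        | zero =>
          refine Submodule.subset_span ⟨0, j + 1, ?_, ?_⟩
          · simp at hij ⊢; omega
          · simp [pow_succ']
        | succ i =>
          simp only [Bool.false_eq_true, if_false]
          rw [← mul_assoc, mul_pow_succ_of_mul_eq h, add_mul, smul_mul_assoc]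
          refine add_mem (Submodule.subset_span ⟨i + 1, j + 1, ?_, ?_⟩)
            (Submodule.smul_mem _ _ (Submodule.subset_span ⟨i, j, ?_, rfl⟩))
          · simp; omega
          · rw [mul_assoc, ← pow_succ']
          · simp; omega

/-- A balanced word in operators `u`, `d` satisfying the projection formula acts as
multiplication by its value at `1`. -/
theorem prod_word_apply_eq_mul {C : Type*} [CommRing C] [Algebra R C] {u d : Module.End R C}
    {c : R} (h : d * u = u * d + c • 1) (hproj : ∀ z x, u (z * d x) = u z * x) (hd : d 1 = 1)
    {w : List Bool} (hw : BalancedWord w) (x : C) :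
    (w.map fun b => if b then u else d).prod x =
      (w.map fun b => if b then u else d).prod 1 * x := by
  have hpow : ∀ (i : ℕ) (z y : C), (u ^ i) (z * (d ^ i) y) = (u ^ i) z * y := by
    intro i
    induction i with
    | zero => simp
    | succ i ih =>
      intro z y
      rw [pow_succ u, pow_succ' d, Module.End.mul_apply, Module.End.mul_apply, hproj, ih,
        Module.End.mul_apply]
  have hd1 : ∀ i : ℕ, (d ^ i) 1 = 1 := by
    intro i
    induction i with
    | zero => simp
    | succ i ih => rw [pow_succ, Module.End.mul_apply, hd, ih]
  have hmem := prod_word_mem_span (R := R) (A := Module.End R C) h w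
  generalize (w.map fun b => if b then u else d).prod = p at hmem
  induction hmem using Submodule.span_induction with
  | zero => simp
  | add p q _ _ hp hq => simp only [LinearMap.add_apply, hp, hq, add_mul]
  | smul t p _ hp => simp only [LinearMap.smul_apply, hp, smul_mul_assoc]
  | mem p hp =>
    obtain ⟨i, j, hij, rfl⟩ := hp
    have hw' : w.count true = w.count false := hw
    obtain rfl : i = j := by omega
    simpa [hd1] using hpow i 1 x

end Words

section Tower

variable {K L : Type} [Group K] [Fintype K] [Group L] [Fintype L] (φ : K →* L)

theorem indMat_mulVec_conj (x : K → ℂ) (g h : L) :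
    (indMat φ).mulVec x (h * g * h⁻¹) = (indMat φ).mulVec x g := by
  classical
  simp only [Matrix.mulVec, dotProduct, indMat]
  refine Finset.sum_congr rfl fun k _ => ?_
  congr 2
  refine Fintype.sum_equiv (Equiv.mulLeft h⁻¹) _ _ fun y => ?_
  simp [mul_assoc]

/-- The projection formula `Ind (x · Res y) = Ind x · y`. -/
theorem indMat_mulVec_mul_comp (x : K → ℂ) {y : L → ℂ} (hy : y ∈ classFunctions L) :
    (indMat φ).mulVec (x * (y ∘ φ)) = (indMat φ).mulVec x * y := by
  classical
  funext g
  simp only [Matrix.mulVec, dotProduct, Pi.mul_apply, Function.comp_apply, indMat, Finset.mul_sum,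
    Finset.sum_mul]
  refine Finset.sum_congr rfl fun k _ => Finset.sum_congr rfl fun l _ => ?_
  split_ifs with hk
  · have : y (φ k) = y g := by
      rw [hk]
      simpa using hy g l⁻¹
    rw [this]
    ring
  · simp

variable {G : ℕ → Type} [∀ n, Group (G n)] [∀ n, Fintype (G n)] (f : ∀ n, G n →* G (n + 1))

theorem wordOpRep_cons (b : Bool) (w : List Bool) (X : ∀ n, G n → ℂ) :
    wordOpRep G f (b :: w) X = (if b then IndOp G f else ResOp G f) (wordOpRep G f w X) := rfl

/-- The degree `n` component of a word operator only depends on one component of the input. -/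
theorem wordOpRep_apply_congr (w : List Bool) {m n : ℕ}
    (h : n + w.count false = m + w.count true) {X Y : ∀ n, G n → ℂ} (hXY : X m = Y m) :
    wordOpRep G f w X n = wordOpRep G f w Y n := by
  induction w generalizing n with
  | nil =>
    obtain rfl : n = m := by simpa using h
    exact hXY
  | cons b w ih =>
    rw [wordOpRep_cons, wordOpRep_cons]
    cases b with
    | true =>
      cases n with
      | zero => rfl
      | succ n =>
        have := ih (n := n) (by simp at h; omega)
        exact congrArg (indMat (f n)).mulVecLin this
    | false =>
      have := ih (n := n + 1) (by simp at h; omega)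
      exact congrArg (fun z => z ∘ f n) this

variable (G) in
/-- The algebra of graded class functions on a tower of groups. -/
def gradedClassFunctions : Subalgebra ℂ (∀ n, G n → ℂ) where
  carrier := {X | ∀ n, X n ∈ classFunctions (G n)}
  add_mem' hX hY n := add_mem (hX n) (hY n)
  mul_mem' hX hY n := mul_mem (hX n) (hY n)
  algebraMap_mem' t n := (classFunctions (G n)).algebraMap_mem t

theorem IndOp_mem (X : ∀ n, G n → ℂ) : IndOp G f X ∈ gradedClassFunctions G := by
  intro n
  cases n with
  | zero => exact zero_mem _
  | succ n => exact indMat_mulVec_conj (f n) (X n)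

theorem ResOp_mem {X : ∀ n, G n → ℂ} (hX : X ∈ gradedClassFunctions G) :
    ResOp G f X ∈ gradedClassFunctions G := by
  intro n g h
  simpa [ResOp] using hX (n + 1) (f n g) (f n h)

theorem IndOp_mul_ResOp (X : ∀ n, G n → ℂ) {Y : ∀ n, G n → ℂ} (hY : Y ∈ gradedClassFunctions G) :
    IndOp G f (X * ResOp G f Y) = IndOp G f X * Y := by
  funext n
  cases n with
  | zero => exact (zero_mul (Y 0)).symm
  | succ n => exact indMat_mulVec_mul_comp (f n) (X n) (hY (n + 1))

variable {f}

/-- The commutation relation of a differential tower holds on all graded class functions. -/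
theorem ResOp_IndOp_eq {r : ℕ} (h2 : DTG2 r G f) {X : ∀ n, G n → ℂ}
    (hX : X ∈ gradedClassFunctions G) :
    ResOp G f (IndOp G f X) = IndOp G f (ResOp G f X) + (r : ℂ) • X := by
  funext n
  have hspan : Submodule.span ℂ (Set.range fun V : FDRep ℂ (G n) => V.character) ≤
      LinearMap.eqLocus
        (LinearMap.proj n ∘ₗ (ResOp G f ∘ₗ IndOp G f - IndOp G f ∘ₗ ResOp G f) ∘ₗ
          LinearMap.single ℂ (fun m => G m → ℂ) n) ((r : ℂ) • LinearMap.id) := by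
    rw [Submodule.span_le]
    rintro _ ⟨V, rfl⟩
    exact h2 n V.character (Submodule.subset_span ⟨V, rfl⟩) (Pi.single n V.character)
      ⟨Pi.single_eq_same n _, fun m hm => Pi.single_eq_of_ne hm _⟩
  have hn := hspan (classFunctions_le_span _ (fun V _ => Set.mem_range_self V) (hX n))
  have hDU := wordOpRep_apply_congr f [false, true] (m := n) (n := n) (by simp)
    (X := X) (Y := Pi.single n (X n)) (by rw [Pi.single_eq_same])
  have hUD := wordOpRep_apply_congr f [true, false] (m := n) (n := n) (by simp)
    (X := X) (Y := Pi.single n (X n)) (by rw [Pi.single_eq_same])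
  change ResOp G f (IndOp G f X) n = ResOp G f (IndOp G f _) n at hDU
  change IndOp G f (ResOp G f X) n = IndOp G f (ResOp G f _) n at hUD
  rw [Pi.add_apply, hDU, hUD]
  exact sub_eq_iff_eq_add'.1 hn

theorem wordOpRep_eq_mul {r : ℕ} (h2 : DTG2 r G f) {w : List Bool} (hw : BalancedWord w)
    {X : ∀ n, G n → ℂ} (hX : X ∈ gradedClassFunctions G) :
    wordOpRep G f w X = wordOpRep G f w 1 * X := by
  let u : Module.End ℂ (gradedClassFunctions G) :=
    ((IndOp G f).comp (gradedClassFunctions G).val.toLinearMap).codRestrict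
      (Subalgebra.toSubmodule (gradedClassFunctions G)) fun Y => IndOp_mem f Y
  let d : Module.End ℂ (gradedClassFunctions G) :=
    ((ResOp G f).comp (gradedClassFunctions G).val.toLinearMap).codRestrict
      (Subalgebra.toSubmodule (gradedClassFunctions G)) fun Y => ResOp_mem f Y.2
  have hword : ∀ (w : List Bool) (Y : gradedClassFunctions G),
      ((w.map fun b => if b then u else d).prod Y : ∀ n, G n → ℂ) = wordOpRep G f w Y := by
    intro w Y
    induction w with
    | nil => rfl
    | cons b w ih =>
      rw [wordOpRep_cons, ← ih]
      cases b <;> rfl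
  have key := prod_word_apply_eq_mul (u := u) (d := d) (c := (r : ℂ))
    (LinearMap.ext fun Y => Subtype.ext (ResOp_IndOp_eq h2 Y.2))
    (fun Z Y => Subtype.ext (IndOp_mul_ResOp f Z Y.2)) rfl hw ⟨X, hX⟩
  have := congrArg Subtype.val key
  rw [hword] at this
  rw [this]
  change _ * X = _
  rw [hword]
  rfl

/-- In a differential tower, a combination of balanced words acts on class functions of `G n` as
multiplication by its value at the trivial character. -/
theorem sum_wordOpRep_apply_eq_mul {r : ℕ} (h2 : DTG2 r G f) {ι : Type*} [Fintype ι] (c : ι → ℕ)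
    {ws : ι → List Bool} (hbal : ∀ i, BalancedWord (ws i)) (n : ℕ) {X : ∀ n, G n → ℂ}
    (hX : X n ∈ classFunctions (G n)) :
    (∑ i, c i • wordOpRep G f (ws i)) X n =
      (∑ i, c i • wordOpRep G f (ws i)) (fun m => if m = n then (fun _ => 1) else 0) n * X n := by
  have hlocal : ∀ i, ∀ Y Z : ∀ n, G n → ℂ, Y n = Z n →
      wordOpRep G f (ws i) Y n = wordOpRep G f (ws i) Z n := fun i Y Z h =>
    wordOpRep_apply_congr f (ws i) (congrArg (n + ·) (hbal i).symm) h
  simp only [LinearMap.sum_apply, LinearMap.smul_apply, Finset.sum_apply, Pi.smul_apply,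
    Finset.sum_mul, smul_mul_assoc]
  refine Finset.sum_congr rfl fun i _ => ?_
  have hsingle : Pi.single n (X n) ∈ gradedClassFunctions G := by
    intro m
    by_cases hm : m = n
    · subst hm
      rwa [Pi.single_eq_same]
    · rw [Pi.single_eq_of_ne hm]
      exact zero_mem _
  rw [hlocal i X (Pi.single n (X n)) (by rw [Pi.single_eq_same]),
    wordOpRep_eq_mul h2 (hbal i) hsingle, Pi.mul_apply, Pi.single_eq_same,
    hlocal i 1 (fun m => if m = n then (fun _ => 1) else 0) (by rw [if_pos rfl]; rfl)]

end Tower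

theorem repRing_le_classFunctions {G : Type} [Group G] [Fintype G] {x : G → ℂ}
    (hx : x ∈ repRing G) : x ∈ classFunctions G := by
  have : repRing G ≤ (Subalgebra.toSubmodule (classFunctions G)).restrictScalars ℤ := by
    rw [repRing, Submodule.span_le]
    rintro _ ⟨V, rfl⟩
    exact V.char_conj
  exact this hx

/-- Pairwise non-isomorphic simple representations have linearly independent characters. -/
theorem linearIndependent_character {G : Type} [Group G] [Fintype G] {I : Type*}
    {W : I → FDRep ℂ G} (hsimple : ∀ i, Simple (W i))
    (hdistinct : ∀ i j, i ≠ j → ¬ Nonempty (W i ≅ W j)) :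
    LinearIndependent ℂ fun i => (W i).character := by
  classical
  have : Invertible (Nat.card G : ℂ) := invertibleOfNonzero (by simp)
  rw [linearIndependent_iff']
  intro s c hc j hj
  have h : (Nat.card G : ℂ)⁻¹ *
      ∑ g, (∑ i ∈ s, c i • (W i).character) g * (W j).character g⁻¹ = c j := by
    simp only [Finset.sum_apply, Pi.smul_apply, smul_eq_mul, Finset.sum_mul]
    rw [Finset.sum_comm, Finset.mul_sum, Finset.sum_eq_single_of_mem j hj]
    · have := FDRep.char_orthonormal (W j) (W j)
      rw [if_pos ⟨Iso.refl _⟩] at this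
      simp only [mul_assoc]
      rw [← Finset.mul_sum, mul_left_comm, this, mul_one]
    · intro i _ hij
      have := FDRep.char_orthonormal (W i) (W j)
      rw [if_neg (hdistinct i j hij)] at this
      simp only [mul_assoc]
      rw [← Finset.mul_sum, mul_left_comm, this, mul_zero]
  rw [← h, hc]
  simp

/-- The character table of a finite group is an invertible matrix. -/
theorem characterTable_bijective {G : Type} [Group G] [Fintype G] {I : Type*} [Fintype I]
    {W : I → FDRep ℂ G} (hsimple : ∀ i, Simple (W i))
    (hdistinct : ∀ i j, i ≠ j → ¬ Nonempty (W i ≅ W j))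
    (hcomplete : ∀ X : FDRep ℂ G, Simple X → ∃ i, Nonempty (X ≅ W i))
    {reps : Finset G} (hreps : ∀ g : G, ∃! x, x ∈ reps ∧ IsConj x g) :
    Function.Bijective
      (Matrix.of fun (x : reps) i => (W i).character x).mulVecLin := by
  choose p hp hpuniq using hreps
  have happly : ∀ (c : I → ℂ) (x : reps),
      (Matrix.of fun (x : reps) i => (W i).character x).mulVecLin c x =
        (∑ i, c i • (W i).character) x := fun c x => by
    simp [Matrix.mulVec, dotProduct, mul_comm]
  constructor
  · rw [injective_iff_map_eq_zero]
    intro c hc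
    have hclass : ∑ i, c i • (W i).character ∈ classFunctions G :=
      sum_mem fun i _ => Subalgebra.smul_mem (classFunctions G) (fun g h => (W i).char_conj g h) _
    have hzero : ∑ i, c i • (W i).character = 0 := by
      funext g
      rw [← apply_eq_of_isConj hclass (hp g).2, ← happly c ⟨p g, (hp g).1⟩, hc]
      rfl
    funext i
    exact Fintype.linearIndependent_iff.1 (linearIndependent_character hsimple hdistinct) c hzero i
  · intro y
    have hclass : (fun g => y ⟨p g, (hp g).1⟩) ∈ classFunctions G := by
      intro g h
      refine congrArg y (Subtype.ext (hpuniq _ _ ⟨(hp _).1, (hp _).2.trans ?_⟩))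
      exact (isConj_iff.2 ⟨h, rfl⟩).symm
    have hmem := classFunctions_le_span (Set.range fun i => (W i).character)
      (fun V hV => by
        obtain ⟨i, ⟨e⟩⟩ := hcomplete V hV
        exact ⟨i, (FDRep.char_iso e).symm⟩) hclass
    obtain ⟨c, hc⟩ := (Submodule.mem_span_range_iff_exists_fun ℂ).1 hmem
    refine ⟨c, funext fun x => ?_⟩
    rw [happly, hc]
    exact congrArg y (Subtype.ext (hpuniq x x ⟨x.2, IsConj.refl _⟩).symm)

/-- If `P * a = diagonal v * P` with `P` invertible, then the roots of the characteristic
polynomial of `a` are the entries of `v`. -/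
theorem charpoly_roots_of_mul_eq_diagonal_mul {K I J : Type*} [Field K] [Fintype I] [DecidableEq I]
    [Fintype J] [DecidableEq J] {P : Matrix J I K} (hP : Function.Bijective P.mulVecLin)
    {a : Matrix I I K} {v : J → K} (h : P * a = Matrix.diagonal v * P) :
    a.charpoly.roots = Finset.univ.val.map v := by
  let e := LinearEquiv.ofBijective P.mulVecLin hP
  have hconj : e.conj (Matrix.toLin' a) = Matrix.toLin' (Matrix.diagonal v) := by
    refine LinearMap.ext fun y => ?_
    obtain ⟨x, rfl⟩ := e.surjective y
    have := congrArg (fun M : Matrix J I K => M.mulVec x) h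
    rw [LinearEquiv.conj_apply_apply, e.symm_apply_apply]
    simpa [e, Matrix.mulVec_mulVec] using this
  have hchar : a.charpoly = (Matrix.diagonal v).charpoly := by
    rw [← Matrix.charpoly_toLin', ← Matrix.charpoly_toLin', ← hconj, LinearEquiv.charpoly_conj]
  rw [hchar, Matrix.charpoly_diagonal]
  simpa [Multiset.map_map] using
    Polynomial.roots_multiset_prod_X_sub_C ((Finset.univ : Finset J).val.map v)

/-- Proposition 4.3 of the paper.  Let `G 0 ⊆ G 1 ⊆ ⋯` be an
`r`-differential tower of groups and `f = ∑ i, c i · w i` a finite sum of balanced words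
with nonnegative integer coefficients, acting as `f(Ind, Res)` on the graded
representation ring.  Set `V(f)_n := f(Ind,Res)[1_{G n}]`, with character `Vfchar`.
Then multiplication by `[V(f)_n]` equals the operator `f(Ind, Res)` on `R(G n)`, and the
multiset of character values of `V(f)_n` (one for each conjugacy class) equals the
multiset of eigenvalues of `f(Ind,Res)` on `R(G n) ⊗ ℂ` (the roots of the
characteristic polynomial of its matrix `a` in the basis of irreducibles). -/
theorem stmt10 (r : ℕ) (hr : 0 < r)
    (G : ℕ → Type) [∀ n, Group (G n)] [∀ n, Fintype (G n)]
    (f : ∀ n, G n →* G (n + 1)) (hinj : ∀ n, Function.Injective (f n))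
    (htriv : Fintype.card (G 0) = 1)
    (h1 : DTG1 G f) (h2 : DTG2 r G f)
    -- the formal sum `f = ∑ i, c i · w i` of balanced words, with nonnegative
    -- coefficients
    (ι : Type) [Fintype ι] (c : ι → ℕ) (ws : ι → List Bool)
    (hbal : ∀ i, BalancedWord (ws i))
    (n : ℕ)
    -- a complete family of pairwise non-isomorphic irreducible representations of `G n`
    (I : Type) [Fintype I] [DecidableEq I] (W : I → FDRep ℂ (G n))
    (hsimple : ∀ i, Simple (W i))
    (hdistinct : ∀ i j, i ≠ j → ¬ Nonempty (W i ≅ W j))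
    (hcomplete : ∀ X : FDRep ℂ (G n), Simple X → ∃ i, Nonempty (X ≅ W i))
    -- a set of conjugacy class representatives of `G n`
    (reps : Finset (G n))
    (hreps : ∀ g : G n, ∃! x, x ∈ reps ∧ IsConj x g)
    -- `a` is the matrix of the operator `f(Ind, Res)` on `R(G n)` in the basis of the
    -- irreducible characters
    (a : Matrix I I ℂ)
    (ha : ∀ j : I, ∀ X : ∀ m, G m → ℂ,
      (X n = (W j).character ∧ ∀ m, m ≠ n → X m = 0) →
        (∑ i : ι, c i • wordOpRep G f (ws i)) X n = ∑ i : I, a i j • (W i).character) :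
    -- multiplication by the character of `V(f)_n` agrees with the operator
    -- `f(Ind, Res)` on `R(G n)`…
    (∀ x ∈ repRing (G n), ∀ X : ∀ m, G m → ℂ,
      (X n = x ∧ ∀ m, m ≠ n → X m = 0) →
        ((∑ i : ι, c i • wordOpRep G f (ws i))
            (fun m => if m = n then (fun _ => 1) else 0) n) * x
          = (∑ i : ι, c i • wordOpRep G f (ws i)) X n) ∧
    -- …and the multiset of character values of `V(f)_n` equals the multiset of
    -- eigenvalues of `f(Ind, Res)` on `R(G n) ⊗ ℂ`
    (Matrix.charpoly a).roots
      = Multiset.map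
          ((∑ i : ι, c i • wordOpRep G f (ws i))
            (fun m => if m = n then (fun _ => 1) else 0) n)
          reps.val := by
  classical
  have hmul := fun (X : ∀ m, G m → ℂ) => sum_wordOpRep_apply_eq_mul h2 c hbal n (X := X)
  refine ⟨fun x hx X hX => ?_, ?_⟩
  · rw [hmul X (hX.1 ▸ repRing_le_classFunctions hx), hX.1]
  · set φ := (∑ i : ι, c i • wordOpRep G f (ws i))
      (fun m => if m = n then (fun _ => 1) else 0) n
    rw [charpoly_roots_of_mul_eq_diagonal_mul (v := fun x : reps => φ x)
      (characterTable_bijective hsimple hdistinct hcomplete hreps)]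
    · exact (Multiset.map_map φ Subtype.val _).symm.trans
        (congrArg (Multiset.map φ) (Multiset.attach_map_val reps.val))
    · ext x j
      have hX : (Pi.single n (W j).character : ∀ m, G m → ℂ) n = (W j).character :=
        Pi.single_eq_same n _
      have hj := ha j (Pi.single n (W j).character)
        ⟨hX, fun m hm => Pi.single_eq_of_ne hm _⟩
      rw [hmul _ (by rw [hX]; exact (W j).char_conj), hX] at hj
      have := congrFun hj x
      rw [Matrix.diagonal_mul, Matrix.mul_apply]
      simpa [mul_comm] using this.symm
end

section
/- Fix r ≥ 1, n ≥ 1, and k ≤ n, and let M be the matrix of U^kD^k : ℤ^{(Y^r)_n} → ℤ^{(Y^r)_n} in the standard basis of rank-n elements. Define S_k = {𝛌 ∈ (Y^r)_n : λ^{(r)} has at least k parts equal to 1} and T_k = {𝛌 ∈ (Y^r)_n : the conjugate partition (λ^{(1)})' has at least k parts equal to 1}. Then |S_k| = |T_k| = p_{n−k}, and the square submatrix M_{S_k, T_k} (rows indexed by S_k and columns by T_k, each ordered r-lexicographically) is lower unitriangular; in particular det M_{S_k, T_k} = 1, so M has a p_{n−k} × p_{n−k} minor equal to ±1. -/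
theorem cell_lt_card {μ : YoungDiagram} {x y : ℕ} (h : (x, y) ∈ μ) :
    x < μ.card ∧ y < μ.card := by
  constructor
  · have hsub : ∀ j ∈ Finset.range (x + 1), (j, y) ∈ μ.cells := by
      intro j hj
      rw [YoungDiagram.mem_cells]
      exact μ.up_left_mem (Nat.lt_succ_iff.mp (Finset.mem_range.mp hj)) le_rfl h
    have hinj : Set.InjOn (fun j => ((j, y) : ℕ × ℕ)) (Finset.range (x + 1)) := by
      intro a _ b _ hab
      simpa using congrArg Prod.fst hab
    have := Finset.card_le_card_of_injOn _ hsub hinj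
    simpa [YoungDiagram.card] using this
  · have hsub : ∀ j ∈ Finset.range (y + 1), (x, j) ∈ μ.cells := by
      intro j hj
      rw [YoungDiagram.mem_cells]
      exact μ.up_left_mem le_rfl (Nat.lt_succ_iff.mp (Finset.mem_range.mp hj)) h
    have hinj : Set.InjOn (fun j => ((x, j) : ℕ × ℕ)) (Finset.range (y + 1)) := by
      intro a _ b _ hab
      simpa using congrArg Prod.snd hab
    have := Finset.card_le_card_of_injOn _ hsub hinj
    simpa [YoungDiagram.card] using this

/-- rank-`n` elements of `Y^r`: `r`-tuples of Young diagrams with `n` cells in total. -/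
def YR (r n : ℕ) : Type := {l : Fin r → YoungDiagram // ∑ i, (l i).card = n}

instance (r n : ℕ) : Finite (YR r n) := by
  have hinj : Function.Injective
      (fun (l : YR r n) (i : Fin r) (p : Fin (n + 1) × Fin (n + 1)) =>
        decide ((p.1.1, p.2.1) ∈ l.1 i)) := by
    intro l m h
    have hbound : ∀ (l : YR r n) (i : Fin r) (x y : ℕ), (x, y) ∈ l.1 i → x ≤ n ∧ y ≤ n := by
      intro l i x y hm
      have hc : (l.1 i).card ≤ n :=
        le_of_le_of_eq (Finset.single_le_sum (f := fun j => (l.1 j).card)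
          (fun _ _ => Nat.zero_le _) (Finset.mem_univ i)) l.2
      obtain ⟨h1, h2⟩ := cell_lt_card hm
      exact ⟨le_trans (Nat.le_of_lt h1) hc, le_trans (Nat.le_of_lt h2) hc⟩
    apply Subtype.ext
    funext i
    apply SetLike.ext
    rintro ⟨x, y⟩
    constructor
    · intro hx
      obtain ⟨h1, h2⟩ := hbound l i x y hx
      have := congrFun (congrFun h i) (⟨x, Nat.lt_succ_of_le h1⟩, ⟨y, Nat.lt_succ_of_le h2⟩)
      simpa [hx] using this.symm
    · intro hx
      obtain ⟨h1, h2⟩ := hbound m i x y hx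
      have := congrFun (congrFun h i) (⟨x, Nat.lt_succ_of_le h1⟩, ⟨y, Nat.lt_succ_of_le h2⟩)
      simpa [hx] using this
  exact Finite.of_injective _ hinj

noncomputable instance (r n : ℕ) : Fintype (YR r n) := Fintype.ofFinite _

open Classical in
/-- the up matrix of `Y^r` from rank `m` to rank `m+1`: entry `(μ, λ) = 1` iff `λ ⋖ μ`
(covers in the product order: `μ` is obtained from `λ` by adding one box). -/
noncomputable def upMat (r m : ℕ) : Matrix (YR r (m + 1)) (YR r m) ℤ :=
  fun b a => if (a.1 : Fin r → YoungDiagram) ⋖ b.1 then 1 else 0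

open Classical in
/-- the down matrix of `Y^r` from rank `m+1` to rank `m`. -/
noncomputable def downMat (r m : ℕ) : Matrix (YR r m) (YR r (m + 1)) ℤ :=
  fun a b => if (a.1 : Fin r → YoungDiagram) ⋖ b.1 then 1 else 0

/-- the up map `U` on the graded space `⨁ₙ ℤ^{(Y^r)ₙ}`: `Ux = ∑_{x ⋖ y} y`. -/
noncomputable def Uop (r : ℕ) : (∀ n, YR r n → ℤ) →ₗ[ℤ] (∀ n, YR r n → ℤ) where
  toFun x n := match n with
    | 0 => 0
    | (m + 1) => (upMat r m).mulVecLin (x m)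
  map_add' x y := by
    funext n
    cases n with
    | zero => show (0 : YR r 0 → ℤ) = 0 + 0; simp
    | succ m => exact map_add _ _ _
  map_smul' c x := by
    funext n
    cases n with
    | zero => show (0 : YR r 0 → ℤ) = c • 0; simp
    | succ m => exact map_smul _ c _

/-- the down map `D` on the graded space `⨁ₙ ℤ^{(Y^r)ₙ}`: `Dy = ∑_{x ⋖ y} x`
(in particular `D = 0` on rank `0`). -/
noncomputable def Dop (r : ℕ) : (∀ n, YR r n → ℤ) →ₗ[ℤ] (∀ n, YR r n → ℤ) where
  toFun x n := (downMat r n).mulVecLin (x (n + 1))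
  map_add' x y := by funext n; exact map_add _ _ _
  map_smul' c x := by funext n; exact map_smul _ c _

/-- the operator `w(U, D)` on the graded space `⨁ₙ ℤ^{(Y^r)ₙ}`: the letters of `w` are
applied right to left. -/
noncomputable def wordOpY (r : ℕ) (w : List Bool) :
    (∀ n, YR r n → ℤ) →ₗ[ℤ] (∀ n, YR r n → ℤ) :=
  w.foldr (fun b acc => (if b then Uop r else Dop r) ∘ₗ acc) LinearMap.id

open Classical in
/-- the basis vector of the graded space concentrated at `μ`. -/
noncomputable def deltaY {r n : ℕ} (μ : YR r n) : ∀ m, YR r m → ℤ :=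
  fun _ ν => if (ν.1 : Fin r → YoungDiagram) = μ.1 then 1 else 0

/-- the matrix of `w(U,D)ₙ : ℤ^{(Y^r)ₙ} → ℤ^{(Y^r)ₙ}` (for a balanced word `w`) in the
standard basis: entry `(λ, μ)` is the coefficient of `λ` in `w(U,D) μ`. -/
noncomputable def wordMatY (r : ℕ) (w : List Bool) (n : ℕ) :
    Matrix (YR r n) (YR r n) ℤ :=
  fun lam mu => wordOpY r w (deltaY mu) n lam

/-- `d` is a Smith normal form of the square integer matrix `M`: `d` is diagonal with
nonnegative entries, successive entries divide one another, and `d` is obtained from `M`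
by multiplication by matrices invertible over `ℤ`. -/
def IsSNF {N : ℕ} (M : Matrix (Fin N) (Fin N) ℤ) (d : Fin N → ℤ) : Prop :=
  (∀ i, 0 ≤ d i) ∧ (∀ i j : Fin N, i ≤ j → d i ∣ d j) ∧
    ∃ P Q : Matrix (Fin N) (Fin N) ℤ, IsUnit P.det ∧ IsUnit Q.det ∧
      P * M * Q = Matrix.diagonal d

/-- a square matrix indexed by `(Y^r)ₙ`, reindexed by `Fin (#(Y^r)ₙ)`. -/
noncomputable def reidx (r n : ℕ) (M : Matrix (YR r n) (YR r n) ℤ) :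
    Matrix (Fin (Fintype.card (YR r n))) (Fin (Fintype.card (YR r n))) ℤ :=
  Matrix.reindex (Fintype.equivFin (YR r n)) (Fintype.equivFin (YR r n)) M

/-- the rank sizes of `Y^r`:
`p_m = ∑_{i₁+⋯+i_r=m} p(i₁)⋯p(i_r)` with `p` the number-of-partitions function. -/
def pFormula (r m : ℕ) : ℕ :=
  ∑ c ∈ Finset.Nat.antidiagonalTuple r m, ∏ i, Fintype.card (Nat.Partition (c i))


noncomputable instance (r n : ℕ) : DecidableEq (YR r n) := Classical.decEq _

/-- lexicographic order on partitions (Young diagrams): first compare sizes (a diagram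
with more boxes is lexicographically greater), then compare the lists of row lengths
lexicographically. -/
def pLexLT (μ ν : YoungDiagram) : Prop :=
  μ.card < ν.card ∨ (μ.card = ν.card ∧ μ.rowLens < ν.rowLens)

/-- the `r`-lexicographic order on `r`-tuples of partitions: lexicographic order on
`λ⁽¹⁾`, then `λ⁽²⁾`, and so on. -/
def rlexLT {r : ℕ} (x y : Fin r → YoungDiagram) : Prop :=
  ∃ i, (∀ j, j < i → x j = y j) ∧ pLexLT (x i) (y i)

namespace YoungDiagram

/-- `μ` with `k` additional parts equal to `1`. -/
def addOnes (k : ℕ) (μ : YoungDiagram) : YoungDiagram where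
  cells := μ.cells ∪ Finset.Ico (μ.colLen 0) (μ.colLen 0 + k) ×ˢ {0}
  isLowerSet := by
    rintro ⟨x, y⟩ ⟨x', y'⟩ ⟨hx : x' ≤ x, hy : y' ≤ y⟩ h
    simp only [Finset.coe_union, Set.mem_union, Finset.mem_coe, mem_cells, Finset.mem_product,
      Finset.mem_Ico, Finset.mem_singleton] at h ⊢
    rcases h with h | ⟨⟨-, h2⟩, rfl⟩
    · exact .inl (μ.up_left_mem hx hy h)
    · obtain rfl : y' = 0 := by omega
      by_cases hc : x' < μ.colLen 0
      · exact .inl (mem_iff_lt_colLen.2 hc)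
      · exact .inr ⟨⟨by omega, by omega⟩, rfl⟩

theorem mem_addOnes {k : ℕ} {μ : YoungDiagram} {x y : ℕ} :
    (x, y) ∈ addOnes k μ ↔ (x, y) ∈ μ ∨ x < μ.colLen 0 + k ∧ y = 0 := by
  rw [← mem_cells]
  simp only [addOnes, Finset.mem_union, mem_cells, Finset.mem_product, Finset.mem_Ico,
    Finset.mem_singleton]
  constructor
  · tauto
  · rintro (h | ⟨h, rfl⟩)
    · exact .inl h
    · by_cases hc : x < μ.colLen 0
      · exact .inl (mem_iff_lt_colLen.2 hc)
      · exact .inr ⟨⟨by omega, h⟩, rfl⟩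

theorem card_addOnes (k : ℕ) (μ : YoungDiagram) : (addOnes k μ).card = μ.card + k := by
  have h : Disjoint μ.cells (Finset.Ico (μ.colLen 0) (μ.colLen 0 + k) ×ˢ {0}) := by
    rw [Finset.disjoint_left]
    rintro ⟨x, y⟩ h1 h2
    simp only [Finset.mem_product, Finset.mem_Ico, Finset.mem_singleton] at h2
    obtain ⟨⟨h2, -⟩, rfl⟩ := h2
    rw [mem_cells, mem_iff_lt_colLen] at h1
    omega
  rw [YoungDiagram.card, addOnes, Finset.card_union_of_disjoint h, Finset.card_product]
  simp

theorem card_le_card {μ ν : YoungDiagram} (h : μ ≤ ν) : μ.card ≤ ν.card :=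
  Finset.card_le_card (cells_subset_iff.2 h)

theorem eq_of_le_of_card_le {μ ν : YoungDiagram} (h : μ ≤ ν) (hc : ν.card ≤ μ.card) : μ = ν :=
  YoungDiagram.ext (Finset.eq_of_subset_of_card_le (cells_subset_iff.2 h) hc)

theorem card_transpose (μ : YoungDiagram) : μ.transpose.card = μ.card := by
  simp [YoungDiagram.card, transpose]

theorem le_addOnes (k : ℕ) (μ : YoungDiagram) : μ ≤ addOnes k μ := by
  rintro ⟨x, y⟩ h
  exact mem_addOnes.2 (.inl h)

theorem addOnes_zero (μ : YoungDiagram) : addOnes 0 μ = μ :=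
  (eq_of_le_of_card_le (le_addOnes 0 μ) (card_addOnes 0 μ).le).symm

theorem colLen_addOnes (k : ℕ) (μ : YoungDiagram) :
    (addOnes k μ).colLen 0 = μ.colLen 0 + k := by
  refine eq_of_forall_lt_iff fun x => ?_
  rw [← mem_iff_lt_colLen, mem_addOnes, mem_iff_lt_colLen]
  simp only [and_true]
  omega

theorem addOnes_addOnes (j k : ℕ) (μ : YoungDiagram) :
    addOnes j (addOnes k μ) = addOnes (k + j) μ := by
  refine SetLike.ext ?_
  rintro ⟨x, y⟩
  simp only [mem_addOnes, colLen_addOnes]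
  have := @mem_iff_lt_colLen μ x 0
  grind

theorem eq_addOnes_of_le {j k : ℕ} {μ κ : YoungDiagram} (h1 : μ ≤ κ) (h2 : κ ≤ addOnes k μ)
    (hc : κ.card = μ.card + j) : κ = addOnes j μ := by
  by_cases hm : (μ.colLen 0 + j, 0) ∈ κ
  · have : addOnes (j + 1) μ ≤ κ := by
      rintro ⟨x, y⟩ h
      rcases mem_addOnes.1 h with h | ⟨h, rfl⟩
      · exact h1 h
      · exact κ.up_left_mem (by omega) le_rfl hm
    have := card_le_card this
    rw [card_addOnes] at this
    omega
  · refine eq_of_le_of_card_le ?_ (by rw [card_addOnes, hc])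
    rintro ⟨x, y⟩ h
    rcases mem_addOnes.1 (h2 h) with h' | ⟨-, rfl⟩
    · exact mem_addOnes.2 (.inl h')
    · refine mem_addOnes.2 (.inr ⟨?_, rfl⟩)
      by_contra hx
      exact hm (κ.up_left_mem (by omega) le_rfl h)

theorem rowLen_addOnes_of_lt {k x : ℕ} {μ : YoungDiagram} (hx : x < μ.colLen 0) :
    (addOnes k μ).rowLen x = μ.rowLen x := by
  refine eq_of_forall_lt_iff fun y => ?_
  rw [← mem_iff_lt_rowLen, mem_addOnes, ← mem_iff_lt_rowLen]
  refine or_iff_left_of_imp ?_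
  rintro ⟨-, rfl⟩
  exact mem_iff_lt_colLen.2 hx

theorem rowLens_addOnes (k : ℕ) (μ : YoungDiagram) :
    (addOnes k μ).rowLens = μ.rowLens ++ List.replicate k 1 := by
  refine List.ext_getElem (by simp [colLen_addOnes]) fun i h1 h2 => ?_
  rw [get_rowLens]
  by_cases hi : i < μ.colLen 0
  · rw [List.getElem_append_left (by simpa using hi), get_rowLens, rowLen_addOnes_of_lt hi]
  · rw [List.getElem_append_right (by simpa using hi), List.getElem_replicate]
    refine eq_of_forall_lt_iff fun y => ?_
    rw [length_rowLens, colLen_addOnes] at h1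
    rw [← mem_iff_lt_rowLen, mem_addOnes, Nat.lt_one_iff]
    constructor
    · rintro (h | h)
      · exact absurd (mem_iff_lt_colLen.1 (μ.up_left_mem le_rfl (Nat.zero_le y) h)) hi
      · exact h.2
    · exact fun h => .inr ⟨h1, h⟩

theorem rowLens_injective : Function.Injective rowLens := fun _ _ h =>
  equivListRowLens.injective (Subtype.ext h)

theorem addOnes_injective (k : ℕ) : Function.Injective (addOnes k) := fun μ ν h => by
  have := congrArg rowLens h
  rw [rowLens_addOnes, rowLens_addOnes] at this
  exact rowLens_injective (List.append_cancel_right this)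

theorem le_count_one_iff {k : ℕ} {μ : YoungDiagram} :
    k ≤ μ.rowLens.count 1 ↔ ∃ ν, addOnes k ν = μ := by
  constructor
  · intro h
    set l := μ.rowLens with hl
    have hs : l.Pairwise (· ≥ ·) := μ.rowLens_sorted.pairwise
    have hpos : ∀ x ∈ l, 0 < x := μ.pos_of_mem_rowLens
    set w := l.filter (· ≠ 1) ++ List.replicate (l.count 1 - k) 1 with hw
    have hsplit : l = w ++ List.replicate k 1 := by
      rw [hw, List.append_assoc, List.replicate_append_replicate, Nat.sub_add_cancel h]
      refine List.Perm.eq_of_pairwise (le := (· ≥ ·)) (fun a b _ _ h1 h2 => le_antisymm h2 h1)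
        hs ?_ ?_
      · refine List.pairwise_append.2 ⟨hs.filter _, by simp [List.pairwise_replicate], ?_⟩
        intro a ha b hb
        have := hpos a (List.mem_of_mem_filter ha)
        rw [List.eq_of_mem_replicate hb]
        exact this
      · rw [List.perm_iff_count]
        intro a
        rw [List.count_append, List.count_replicate]
        by_cases ha : a = 1
        · subst ha
          have h0 : (l.filter (· ≠ 1)).count 1 = 0 :=
            List.count_eq_zero.2 (by simp [List.mem_filter])
          rw [h0]
          simp
        · rw [List.count_filter (by simpa using ha)]
          simp [Ne.symm ha]
    have hws : w.SortedGE := by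
      rw [hsplit] at hs
      exact (List.pairwise_append.1 hs).1.sortedGE
    have hwpos : ∀ x ∈ w, 0 < x := fun x hx =>
      hpos x (by rw [hsplit]; exact List.mem_append_left _ hx)
    refine ⟨ofRowLens w hws, rowLens_injective ?_⟩
    rw [rowLens_addOnes, rowLens_ofRowLens_eq_self hwpos, ← hl, ← hsplit]
  · rintro ⟨ν, rfl⟩
    simp [rowLens_addOnes]

/-- `μ` with `k` additional boxes in its first row. -/
def addRow (k : ℕ) (μ : YoungDiagram) : YoungDiagram := (addOnes k μ.transpose).transpose

theorem card_addRow (k : ℕ) (μ : YoungDiagram) : (addRow k μ).card = μ.card + k := by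
  rw [addRow, card_transpose, card_addOnes, card_transpose]

theorem addRow_injective (k : ℕ) : Function.Injective (addRow k) := fun μ ν h => by
  rwa [addRow, addRow, transpose_eq_iff, (addOnes_injective k).eq_iff, transpose_eq_iff] at h

theorem addRow_zero (μ : YoungDiagram) : addRow 0 μ = μ := by
  rw [addRow, addOnes_zero, transpose_transpose]

theorem addRow_addRow (j k : ℕ) (μ : YoungDiagram) :
    addRow j (addRow k μ) = addRow (k + j) μ := by
  simp only [addRow, transpose_transpose, addOnes_addOnes]

theorem le_addRow (k : ℕ) (μ : YoungDiagram) : μ ≤ addRow k μ := by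
  rw [addRow, ← transpose_le_iff, transpose_transpose]
  exact le_addOnes k _

theorem eq_addRow_of_le {j k : ℕ} {μ κ : YoungDiagram} (h1 : μ ≤ κ) (h2 : κ ≤ addRow k μ)
    (hc : κ.card = μ.card + j) : κ = addRow j μ := by
  rw [addRow, ← transpose_eq_iff_eq_transpose]
  refine eq_addOnes_of_le (k := k) (transpose_le_iff.2 h1) ?_ (by simpa only [card_transpose])
  rw [← transpose_le_iff, transpose_transpose]
  exact h2

theorem rowLen_addRow (k x : ℕ) (μ : YoungDiagram) :
    (addRow k μ).rowLen x = μ.rowLen x + if x = 0 then k else 0 := by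
  refine eq_of_forall_lt_iff fun y => ?_
  rw [← mem_iff_lt_rowLen, addRow, mem_transpose, Prod.swap_prod_mk, mem_addOnes, mem_transpose,
    Prod.swap_prod_mk, colLen_transpose, mem_iff_lt_rowLen]
  split_ifs with hx
  · subst hx
    simp only [and_true]
    omega
  · simp [hx]

theorem le_count_one_transpose_iff {k : ℕ} {μ : YoungDiagram} :
    k ≤ μ.transpose.rowLens.count 1 ↔ ∃ ν, addRow k ν = μ := by
  rw [le_count_one_iff]
  constructor
  · rintro ⟨ν, h⟩
    exact ⟨ν.transpose, by rw [addRow, transpose_transpose, h, transpose_transpose]⟩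
  · rintro ⟨ν, rfl⟩
    exact ⟨ν.transpose, by rw [addRow, transpose_transpose]⟩

theorem rowLen_pos_iff {μ : YoungDiagram} {x : ℕ} : 0 < μ.rowLen x ↔ x < μ.colLen 0 := by
  rw [← mem_iff_lt_rowLen, mem_iff_lt_colLen]

theorem le_of_rowLen_le {μ ν : YoungDiagram} (h : ∀ x, μ.rowLen x ≤ ν.rowLen x) : μ ≤ ν := by
  rintro ⟨x, y⟩ hm
  exact mem_iff_lt_rowLen.2 ((mem_iff_lt_rowLen.1 hm).trans_le (h x))

theorem rowLen_mono {μ ν : YoungDiagram} (h : μ ≤ ν) (x : ℕ) : μ.rowLen x ≤ ν.rowLen x := by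
  by_contra! hc
  exact absurd (mem_iff_lt_rowLen.1 (h (mem_iff_lt_rowLen.2 hc))) (lt_irrefl _)

theorem rowLens_lt_iff {μ ν : YoungDiagram} :
    μ.rowLens < ν.rowLens ↔
      ∃ p, (∀ j < p, μ.rowLen j = ν.rowLen j) ∧ μ.rowLen p < ν.rowLen p := by
  rw [List.lt_iff_exists]
  constructor
  · rintro (⟨h1, h2⟩ | ⟨i, h1, h2, h3, h4⟩)
    · refine ⟨μ.rowLens.length, fun j hj => ?_, ?_⟩
      · have := List.getElem_of_eq h1 hj
        rw [List.getElem_take, get_rowLens, get_rowLens] at this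
        exact this
      · rw [length_rowLens, length_rowLens] at *
        have := rowLen_pos_iff.2 h2
        have h0 : ¬ 0 < μ.rowLen (μ.colLen 0) := by rw [rowLen_pos_iff]; exact lt_irrefl _
        omega
    · refine ⟨i, fun j hj => ?_, ?_⟩
      · simpa using h3 j hj
      · simpa using h4
  · rintro ⟨p, h1, h2⟩
    have hν : p < ν.colLen 0 := rowLen_pos_iff.1 (by omega)
    by_cases hμ : p < μ.colLen 0
    · exact .inr ⟨p, by simpa using hμ, by simpa using hν, fun j hj => by simpa using h1 j hj,
        by simpa using h2⟩
    · have hle : μ.colLen 0 ≤ p := not_lt.1 hμ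
      refine .inl ⟨List.ext_getElem (by simp; omega) fun j hj _ => ?_, by simp; omega⟩
      rw [length_rowLens] at hj
      simpa using h1 j (by omega)

end YoungDiagram

theorem pLexLT_addRow (k : ℕ) {μ ν : YoungDiagram} (h : pLexLT μ ν) :
    pLexLT (μ.addRow k) (ν.addRow k) := by
  simp only [pLexLT, YoungDiagram.card_addRow, YoungDiagram.rowLens_lt_iff,
    YoungDiagram.rowLen_addRow] at h ⊢
  rcases h with h | ⟨h, p, h1, h2⟩
  · exact .inl (by omega)
  · exact .inr ⟨by omega, p, fun j hj => by rw [h1 j hj], by omega⟩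

theorem rowLen_pos_of_first_difference {μ ν : YoungDiagram} {p : ℕ} (hc : μ.card = ν.card)
    (h1 : ∀ j < p, μ.rowLen j = ν.rowLen j) (h2 : μ.rowLen p < ν.rowLen p) :
    0 < μ.rowLen p := by
  by_contra h0
  have hle : μ ≤ ν := YoungDiagram.le_of_rowLen_le fun x => by
    rcases lt_or_ge x p with hx | hx
    · exact (h1 x hx).le
    · have := μ.rowLen_anti p x hx
      omega
  rw [YoungDiagram.eq_of_le_of_card_le hle hc.ge] at h2
  exact lt_irrefl _ h2

theorem pLexLT_addOnes (k : ℕ) {μ ν : YoungDiagram} (h : pLexLT μ ν) :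
    pLexLT (μ.addOnes k) (ν.addOnes k) := by
  simp only [pLexLT, YoungDiagram.card_addOnes, YoungDiagram.rowLens_lt_iff] at h ⊢
  rcases h with h | ⟨h, p, h1, h2⟩
  · exact .inl (by omega)
  · have hμ := YoungDiagram.rowLen_pos_iff.1 (rowLen_pos_of_first_difference h h1 h2)
    have hν : p < ν.colLen 0 := YoungDiagram.rowLen_pos_iff.1 (by omega)
    refine .inr ⟨by omega, p, fun j hj => ?_, ?_⟩
    · rw [YoungDiagram.rowLen_addOnes_of_lt (hj.trans hμ),
        YoungDiagram.rowLen_addOnes_of_lt (hj.trans hν), h1 j hj]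
    · rwa [YoungDiagram.rowLen_addOnes_of_lt hμ, YoungDiagram.rowLen_addOnes_of_lt hν]

theorem pLexLT_irrefl (μ : YoungDiagram) : ¬ pLexLT μ μ := by
  rintro (h | ⟨-, h⟩) <;> exact lt_irrefl _ h

theorem not_pLexLT_of_le {μ ν : YoungDiagram} (h : μ ≤ ν) : ¬ pLexLT ν μ := fun hlt => by
  have hc := YoungDiagram.card_le_card h
  obtain rfl : μ = ν := YoungDiagram.eq_of_le_of_card_le h (by rcases hlt with hlt | hlt <;> omega)
  exact pLexLT_irrefl _ hlt

theorem not_pLexLT_of_le_addOnes {k : ℕ} {μ ρ : YoungDiagram} (hc : μ.card = ρ.card)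
    (h : ρ ≤ μ.addOnes k) : ¬ pLexLT μ ρ := by
  rintro (hlt | ⟨-, hlt⟩)
  · omega
  · obtain ⟨p, h1, h2⟩ := YoungDiagram.rowLens_lt_iff.1 hlt
    have hμ := YoungDiagram.rowLen_pos_iff.1 (rowLen_pos_of_first_difference hc h1 h2)
    have := YoungDiagram.rowLen_mono h p
    rw [YoungDiagram.rowLen_addOnes_of_lt hμ] at this
    omega

theorem not_pLexLT_of_le_addRow {k : ℕ} {ν ρ : YoungDiagram} (hc : ν.card ≤ ρ.card)
    (h : ρ ≤ ν.addRow k) : ¬ pLexLT ρ ν := by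
  rintro (hlt | ⟨-, hlt⟩)
  · omega
  · obtain ⟨p, h1, h2⟩ := YoungDiagram.rowLens_lt_iff.1 hlt
    have hle : ρ ≤ ν := YoungDiagram.le_of_rowLen_le fun x => by
      rcases lt_trichotomy x p with hx | rfl | hx
      · exact (h1 x hx).le
      · exact h2.le
      · have := YoungDiagram.rowLen_mono h x
        rwa [YoungDiagram.rowLen_addRow, if_neg (by omega), add_zero] at this
    rw [YoungDiagram.eq_of_le_of_card_le hle hc] at h2
    exact lt_irrefl _ h2

section Tuples

variable {r : ℕ}

theorem rlexLT_irrefl (x : Fin r → YoungDiagram) : ¬ rlexLT x x := fun ⟨i, _, h⟩ =>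
  pLexLT_irrefl (x i) h

/-- The embedding into a lexicographic product that induces the `r`-lexicographic order. -/
def rlexKey (x : Fin r → YoungDiagram) : Lex (Fin r → ℕ ×ₗ List ℕ) :=
  toLex fun i => toLex ((x i).card, (x i).rowLens)

theorem rlexKey_injective : Function.Injective (rlexKey (r := r)) := fun x y h => by
  funext i
  have := congrArg (fun z => (ofLex (ofLex z i)).2) h
  exact YoungDiagram.rowLens_injective this

theorem rlexKey_lt_iff {x y : Fin r → YoungDiagram} : rlexKey x < rlexKey y ↔ rlexLT x y := by
  refine exists_congr fun i => and_congr ?_ ?_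
  · refine forall₂_congr fun j _ => ⟨fun h => ?_, fun h => ?_⟩
    · exact YoungDiagram.rowLens_injective (congrArg (fun z => (ofLex z).2) h)
    · exact congrArg (fun μ : YoungDiagram => (toLex (μ.card, μ.rowLens) : ℕ ×ₗ List ℕ)) h
  · exact Prod.Lex.toLex_lt_toLex

theorem rlexLT_trichotomy (x y : Fin r → YoungDiagram) : rlexLT x y ∨ x = y ∨ rlexLT y x := by
  rw [← rlexKey_lt_iff, ← rlexKey_lt_iff, ← rlexKey_injective.eq_iff]
  exact lt_trichotomy _ _

theorem rlexLT_trans {x y z : Fin r → YoungDiagram} (h1 : rlexLT x y) (h2 : rlexLT y z) :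
    rlexLT x z := by
  rw [← rlexKey_lt_iff] at *
  exact h1.trans h2

/-- Apply `f` to the `i`-th component of a tuple. -/
def mapAt (i : Fin r) (f : YoungDiagram → YoungDiagram) (x : Fin r → YoungDiagram) :
    Fin r → YoungDiagram :=
  Function.update x i (f (x i))

theorem mapAt_self (i : Fin r) (f : YoungDiagram → YoungDiagram) (x : Fin r → YoungDiagram) :
    mapAt i f x i = f (x i) := by
  simp [mapAt]

theorem mapAt_of_ne {i j : Fin r} (h : j ≠ i) (f : YoungDiagram → YoungDiagram)
    (x : Fin r → YoungDiagram) : mapAt i f x j = x j := by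
  simp [mapAt, h]

theorem mapAt_mapAt (i : Fin r) (f g : YoungDiagram → YoungDiagram) (x : Fin r → YoungDiagram) :
    mapAt i f (mapAt i g x) = mapAt i (fun μ => f (g μ)) x := by
  simp [mapAt]

theorem mapAt_injective (i : Fin r) {f : YoungDiagram → YoungDiagram}
    (hf : Function.Injective f) : Function.Injective (mapAt i f) := fun x y h => by
  funext j
  have hj := congrFun h j
  by_cases hij : j = i
  · subst hij
    rw [mapAt_self, mapAt_self] at hj
    exact hf hj
  · rwa [mapAt_of_ne hij, mapAt_of_ne hij] at hj

theorem le_mapAt (i : Fin r) {f : YoungDiagram → YoungDiagram} (hf : ∀ μ, μ ≤ f μ)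
    (x : Fin r → YoungDiagram) : x ≤ mapAt i f x := fun j => by
  by_cases hij : j = i
  · subst hij
    rw [mapAt_self]
    exact hf _
  · rw [mapAt_of_ne hij]

theorem rlexLT_mapAt (i : Fin r) {f : YoungDiagram → YoungDiagram}
    (hf : ∀ μ ν, pLexLT μ ν → pLexLT (f μ) (f ν)) {x y : Fin r → YoungDiagram}
    (h : rlexLT x y) : rlexLT (mapAt i f x) (mapAt i f y) := by
  obtain ⟨p, h1, h2⟩ := h
  refine ⟨p, fun j hj => ?_, ?_⟩
  · by_cases hij : j = i
    · subst hij
      rw [mapAt_self, mapAt_self, h1 j hj]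
    · rw [mapAt_of_ne hij, mapAt_of_ne hij, h1 j hj]
  · by_cases hip : p = i
    · subst hip
      rw [mapAt_self, mapAt_self]
      exact hf _ _ h2
    · rwa [mapAt_of_ne hip, mapAt_of_ne hip]

/-- The total number of boxes of a tuple. -/
def tupleCard (x : Fin r → YoungDiagram) : ℕ := ∑ i, (x i).card

theorem YR.tupleCard_eq {m : ℕ} (x : YR r m) : tupleCard x.1 = m := x.2

theorem tupleCard_eq_add (i : Fin r) (x : Fin r → YoungDiagram) :
    tupleCard x = (x i).card + ∑ j ∈ Finset.univ.erase i, (x j).card :=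
  (Finset.add_sum_erase _ _ (Finset.mem_univ i)).symm

theorem tupleCard_mapAt {k : ℕ} (i : Fin r) {f : YoungDiagram → YoungDiagram}
    (hf : ∀ μ, (f μ).card = μ.card + k) (x : Fin r → YoungDiagram) :
    tupleCard (mapAt i f x) = tupleCard x + k := by
  rw [tupleCard_eq_add i, tupleCard_eq_add i x, mapAt_self, hf,
    Finset.sum_congr rfl fun j hj => by rw [mapAt_of_ne (Finset.ne_of_mem_erase hj)]]
  omega

theorem tupleCard_mono {x y : Fin r → YoungDiagram} (h : x ≤ y) : tupleCard x ≤ tupleCard y :=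
  Finset.sum_le_sum fun i _ => YoungDiagram.card_le_card (h i)

theorem eq_of_le_of_tupleCard_le {x y : Fin r → YoungDiagram} (h : x ≤ y)
    (hc : tupleCard y ≤ tupleCard x) : x = y := by
  funext i
  have h1 := (Finset.sum_eq_sum_iff_of_le fun j _ => YoungDiagram.card_le_card (h j)).1
    (le_antisymm (tupleCard_mono h) hc) i (Finset.mem_univ i)
  exact YoungDiagram.eq_of_le_of_card_le (h i) h1.ge

/-- If `f` adds `j` boxes and `f' μ` is the only diagram with `j` more boxes than `μ` that lies
between `μ` and `g μ`, the same holds for the tuples obtained by applying the maps in one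
component. -/
theorem eq_mapAt_of_le {j : ℕ} (i : Fin r) {f g : YoungDiagram → YoungDiagram}
    (hfg : ∀ μ κ, μ ≤ κ → κ ≤ g μ → κ.card = μ.card + j → κ = f μ)
    {x y : Fin r → YoungDiagram} (h1 : x ≤ y) (h2 : y ≤ mapAt i g x)
    (hc : tupleCard y = tupleCard x + j) : y = mapAt i f x := by
  have hne : ∀ l, l ≠ i → y l = x l := fun l hl =>
    le_antisymm ((h2 l).trans_eq (mapAt_of_ne hl g x)) (h1 l)
  have hi : (y i).card = (x i).card + j := by
    rw [tupleCard_eq_add i, tupleCard_eq_add i x,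
      Finset.sum_congr rfl fun l hl => by rw [hne l (Finset.ne_of_mem_erase hl)]] at hc
    omega
  funext l
  by_cases hl : l = i
  · subst hl
    rw [mapAt_self]
    exact hfg _ _ (h1 l) ((h2 l).trans_eq (mapAt_self l g x)) hi
  · rw [mapAt_of_ne hl, hne l hl]

/-- A tuple obtained by removing boxes from `x` with `k` ones added to its last component is
lexicographically at most `x`. -/
theorem not_rlexLT_of_le_mapAt_addOnes {k : ℕ} {i : Fin r} (hi : ∀ j, j ≤ i)
    {x y : Fin r → YoungDiagram} (h : y ≤ mapAt i (YoungDiagram.addOnes k) x)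
    (hc : tupleCard y = tupleCard x) : ¬ rlexLT x y := by
  rintro ⟨p, h1, h2⟩
  by_cases hp : p = i
  · subst hp
    refine not_pLexLT_of_le_addOnes ?_ ((h p).trans_eq (mapAt_self p _ x)) h2
    rw [tupleCard_eq_add p, tupleCard_eq_add p x, Finset.sum_congr rfl fun l hl => by
      rw [← h1 l (lt_of_le_of_ne (hi l) (Finset.ne_of_mem_erase hl))]] at hc
    omega
  · exact not_pLexLT_of_le ((h p).trans_eq (mapAt_of_ne hp _ x)) h2

/-- A tuple obtained by removing boxes from `x` with `k` boxes added to the first row of its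
first component is lexicographically at least `x`. -/
theorem not_rlexLT_of_le_mapAt_addRow {k : ℕ} {i : Fin r} (hi : ∀ j, i ≤ j)
    {x y : Fin r → YoungDiagram} (h : y ≤ mapAt i (YoungDiagram.addRow k) x)
    (hc : tupleCard y = tupleCard x) : ¬ rlexLT y x := by
  rintro ⟨p, h1, h2⟩
  have hne : ∀ l, l ≠ i → y l ≤ x l := fun l hl => (h l).trans_eq (mapAt_of_ne hl _ x)
  by_cases hp : p = i
  · subst hp
    refine not_pLexLT_of_le_addRow ?_ ((h p).trans_eq (mapAt_self p _ x)) h2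
    have hs : ∑ j ∈ Finset.univ.erase p, (y j).card ≤ ∑ j ∈ Finset.univ.erase p, (x j).card :=
      Finset.sum_le_sum fun l hl => YoungDiagram.card_le_card (hne l (Finset.ne_of_mem_erase hl))
    rw [tupleCard_eq_add p, tupleCard_eq_add p x] at hc
    omega
  · have hle : y ≤ x := fun l => by
      by_cases hl : l = i
      · subst hl
        exact (h1 l (lt_of_le_of_ne (hi p) (Ne.symm hp))).le
      · exact hne l hl
    rw [eq_of_le_of_tupleCard_le hle hc.ge] at h2
    exact pLexLT_irrefl _ h2

end Tuples

section Operators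

variable {r : ℕ}

open Classical in
theorem Uop_apply_succ (x : ∀ n, YR r n → ℤ) (m : ℕ) (l : YR r (m + 1)) :
    Uop r x (m + 1) l = ∑ κ : YR r m, if κ.1 ⋖ l.1 then x m κ else 0 := by
  change (upMat r m).mulVec (x m) l = _
  simp [Matrix.mulVec, dotProduct, upMat]

open Classical in
theorem Dop_apply (x : ∀ n, YR r n → ℤ) (m : ℕ) (l : YR r m) :
    Dop r x m l = ∑ κ : YR r (m + 1), if l.1 ⋖ κ.1 then x (m + 1) κ else 0 := by
  change (downMat r m).mulVec (x (m + 1)) l = _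
  simp [Matrix.mulVec, dotProduct, downMat]

theorem wordOpY_replicate (k : ℕ) (x : ∀ n, YR r n → ℤ) :
    wordOpY r (List.replicate k true ++ List.replicate k false) x =
      (Uop r)^[k] ((Dop r)^[k] x) := by
  have hD : ∀ k, wordOpY r (List.replicate k false) x = (Dop r)^[k] x := by
    intro k
    induction k with
    | zero => rfl
    | succ k ih =>
      rw [Function.iterate_succ_apply', ← ih]
      rfl
  have hU : ∀ j, wordOpY r (List.replicate j true ++ List.replicate k false) x =
      (Uop r)^[j] (wordOpY r (List.replicate k false) x) := by
    intro j
    induction j with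
    | zero => rfl
    | succ j ih =>
      rw [Function.iterate_succ_apply', ← ih]
      rfl
  rw [hU, hD]

/-- The support of `U^k x` lies above the support of `x`. -/
theorem exists_le_of_iterate_Uop_ne_zero {x : ∀ n, YR r n → ℤ} {m : ℕ} (k : ℕ) :
    ∀ {l : YR r (m + k)}, (Uop r)^[k] x (m + k) l ≠ 0 → ∃ ρ : YR r m, ρ.1 ≤ l.1 ∧ x m ρ ≠ 0 := by
  classical
  induction k with
  | zero => exact fun {l} h => ⟨l, le_rfl, h⟩
  | succ k ih =>
    intro l h
    rw [Function.iterate_succ_apply'] at h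
    change Uop r ((Uop r)^[k] x) (m + k + 1) l ≠ 0 at h
    rw [Uop_apply_succ] at h
    obtain ⟨κ, -, hκ⟩ := Finset.exists_ne_zero_of_sum_ne_zero h
    rw [ne_eq, ite_eq_right_iff, Classical.not_imp] at hκ
    obtain ⟨ρ, h1, h2⟩ := ih hκ.2
    exact ⟨ρ, h1.trans hκ.1.le, h2⟩

/-- The support of `D^k x` lies below the support of `x`. -/
theorem exists_le_of_iterate_Dop_ne_zero {x : ∀ n, YR r n → ℤ} (k : ℕ) :
    ∀ {m : ℕ} {l : YR r m}, (Dop r)^[k] x m l ≠ 0 →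
      ∃ (n : ℕ) (κ : YR r n), l.1 ≤ κ.1 ∧ x n κ ≠ 0 := by
  classical
  induction k with
  | zero => exact fun {m l} h => ⟨m, l, le_rfl, h⟩
  | succ k ih =>
    intro m l h
    rw [Function.iterate_succ_apply', Dop_apply] at h
    obtain ⟨κ, -, hκ⟩ := Finset.exists_ne_zero_of_sum_ne_zero h
    rw [ne_eq, ite_eq_right_iff, Classical.not_imp] at hκ
    obtain ⟨n, ρ, h1, h2⟩ := ih hκ.2
    exact ⟨n, ρ, hκ.1.le.trans h1, h2⟩

theorem covBy_of_le_of_tupleCard {x y : Fin r → YoungDiagram} (h : x ≤ y)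
    (hc : tupleCard y = tupleCard x + 1) : x ⋖ y := by
  have hlt : ∀ {a b : Fin r → YoungDiagram}, a < b → tupleCard a < tupleCard b := fun hab => by
    by_contra! hcard
    exact hab.ne (eq_of_le_of_tupleCard_le hab.le hcard)
  refine ⟨lt_of_le_of_ne h (by rintro rfl; omega), fun z h1 h2 => ?_⟩
  have := hlt h1
  have := hlt h2
  omega

theorem mapAt_addOnes_zero (i : Fin r) (x : Fin r → YoungDiagram) :
    mapAt i (YoungDiagram.addOnes 0) x = x := by
  simp [mapAt, YoungDiagram.addOnes_zero]

theorem mapAt_addRow_zero (i : Fin r) (x : Fin r → YoungDiagram) :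
    mapAt i (YoungDiagram.addRow 0) x = x := by
  simp [mapAt, YoungDiagram.addRow_zero]

/-- `x` with `k` parts equal to `1` added to its `i`-th component. -/
def YR.addOnes {m : ℕ} (i : Fin r) (k : ℕ) (x : YR r m) : YR r (m + k) :=
  ⟨mapAt i (YoungDiagram.addOnes k) x.1,
    (tupleCard_mapAt i (YoungDiagram.card_addOnes k) x.1).trans (by rw [x.tupleCard_eq])⟩

/-- `x` with `k` boxes added to the first row of its `i`-th component. -/
def YR.addRow {m : ℕ} (i : Fin r) (k : ℕ) (x : YR r m) : YR r (m + k) :=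
  ⟨mapAt i (YoungDiagram.addRow k) x.1,
    (tupleCard_mapAt i (YoungDiagram.card_addRow k) x.1).trans (by rw [x.tupleCard_eq])⟩

/-- If `x` vanishes on all elements of rank `m` other than `μ` below `μ` with `k` ones added to
a component, then the value of `U^k x` there is `x μ`. -/
theorem iterate_Uop_addOnes {x : ∀ n, YR r n → ℤ} {m : ℕ} (i : Fin r) (μ : YR r m) (k : ℕ)
    (hx : ∀ ρ : YR r m, ρ.1 ≤ mapAt i (YoungDiagram.addOnes k) μ.1 → x m ρ ≠ 0 → ρ = μ) :
    (Uop r)^[k] x (m + k) (μ.addOnes i k) = x m μ := by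
  classical
  induction k with
  | zero =>
    have : μ.addOnes i 0 = μ := Subtype.ext (mapAt_addOnes_zero i μ.1)
    exact congrArg (x m) this
  | succ k ih =>
    have hadd : mapAt i (YoungDiagram.addOnes 1) (mapAt i (YoungDiagram.addOnes k) μ.1) =
        mapAt i (YoungDiagram.addOnes (k + 1)) μ.1 := by
      rw [mapAt_mapAt]
      simp only [YoungDiagram.addOnes_addOnes]
    have hle : mapAt i (YoungDiagram.addOnes k) μ.1 ≤
        mapAt i (YoungDiagram.addOnes (k + 1)) μ.1 :=
      hadd ▸ le_mapAt i (YoungDiagram.le_addOnes 1) _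
    rw [Function.iterate_succ_apply']
    change Uop r ((Uop r)^[k] x) (m + k + 1) (μ.addOnes i (k + 1)) = _
    rw [Uop_apply_succ, Finset.sum_eq_single (μ.addOnes i k)]
    · rw [if_pos, ih fun ρ h => hx ρ (h.trans hle)]
      refine covBy_of_le_of_tupleCard hle ?_
      rw [YR.tupleCard_eq, YR.tupleCard_eq]
      rfl
    · intro κ _ hκ
      rw [ite_eq_right_iff]
      intro hcov
      by_contra h0
      obtain ⟨ρ, h1, h2⟩ := exists_le_of_iterate_Uop_ne_zero k h0
      obtain rfl := hx ρ (h1.trans hcov.le) h2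
      refine hκ (Subtype.ext (eq_mapAt_of_le i (fun _ _ => YoungDiagram.eq_addOnes_of_le)
        h1 hcov.le ?_))
      rw [YR.tupleCard_eq, YR.tupleCard_eq]
    · simp

open Classical in
/-- The basis vector concentrated at the tuple `t`. -/
noncomputable def deltaTuple (t : Fin r → YoungDiagram) : ∀ n, YR r n → ℤ :=
  fun _ ν => if ν.1 = t then 1 else 0

theorem le_of_iterate_Dop_deltaTuple_ne_zero {t : Fin r → YoungDiagram} {k m : ℕ} {l : YR r m}
    (h : (Dop r)^[k] (deltaTuple t) m l ≠ 0) : l.1 ≤ t := by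
  classical
  obtain ⟨n, κ, h1, h2⟩ := exists_le_of_iterate_Dop_ne_zero k h
  rw [deltaTuple, ne_eq, ite_eq_right_iff, Classical.not_imp] at h2
  exact h1.trans_eq h2.1

theorem iterate_Dop_deltaTuple_addRow (i : Fin r) (k : ℕ) :
    ∀ {m : ℕ} (ν : YR r m),
      (Dop r)^[k] (deltaTuple (mapAt i (YoungDiagram.addRow k) ν.1)) m ν = 1 := by
  classical
  induction k with
  | zero =>
    intro m ν
    rw [mapAt_addRow_zero]
    exact if_pos rfl
  | succ k ih =>
    intro m ν
    have hadd : mapAt i (YoungDiagram.addRow k) (ν.addRow i 1).1 =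
        mapAt i (YoungDiagram.addRow (k + 1)) ν.1 := by
      rw [YR.addRow, mapAt_mapAt]
      simp only [YoungDiagram.addRow_addRow, add_comm]
    rw [Function.iterate_succ_apply', Dop_apply, Finset.sum_eq_single (ν.addRow i 1)]
    · rw [if_pos, ← hadd, ih]
      refine covBy_of_le_of_tupleCard (le_mapAt i (YoungDiagram.le_addRow 1) _) ?_
      rw [YR.tupleCard_eq, YR.tupleCard_eq]
    · intro κ _ hκ
      rw [ite_eq_right_iff]
      intro hcov
      by_contra h0
      refine hκ (Subtype.ext (eq_mapAt_of_le i (fun _ _ => YoungDiagram.eq_addRow_of_le)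
        hcov.le (le_of_iterate_Dop_deltaTuple_ne_zero h0) ?_))
      rw [YR.tupleCard_eq, YR.tupleCard_eq]
    · simp

theorem wordMatY_replicate {n : ℕ} (k : ℕ) (a b : YR r n) :
    wordMatY r (List.replicate k true ++ List.replicate k false) n a b =
      (Uop r)^[k] ((Dop r)^[k] (deltaTuple b.1)) n a := by
  rw [wordMatY, wordOpY_replicate]
  rfl

variable {m k : ℕ} {i j : Fin r}

theorem wordMatY_addOnes_addRow_of_rlexLT (hi : ∀ l, l ≤ i) (hj : ∀ l, j ≤ l) {μ ν : YR r m}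
    (h : rlexLT μ.1 ν.1) :
    wordMatY r (List.replicate k true ++ List.replicate k false) (m + k)
      (μ.addOnes i k) (ν.addRow j k) = 0 := by
  rw [wordMatY_replicate]
  by_contra h0
  obtain ⟨ρ, h1, h2⟩ := exists_le_of_iterate_Uop_ne_zero k h0
  have h3 := le_of_iterate_Dop_deltaTuple_ne_zero h2
  have h4 := not_rlexLT_of_le_mapAt_addOnes hi h1 (by rw [YR.tupleCard_eq, YR.tupleCard_eq])
  have h5 := not_rlexLT_of_le_mapAt_addRow hj h3 (by rw [YR.tupleCard_eq, YR.tupleCard_eq])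
  rcases rlexLT_trichotomy ρ.1 μ.1 with h6 | h6 | h6
  · exact h5 (rlexLT_trans h6 h)
  · exact h5 (h6 ▸ h)
  · exact h4 h6

theorem wordMatY_addOnes_addRow_self (hi : ∀ l, l ≤ i) (hj : ∀ l, j ≤ l) (μ : YR r m) :
    wordMatY r (List.replicate k true ++ List.replicate k false) (m + k)
      (μ.addOnes i k) (μ.addRow j k) = 1 := by
  rw [wordMatY_replicate, iterate_Uop_addOnes]
  · exact iterate_Dop_deltaTuple_addRow j k μ
  · intro ρ h1 h2
    have h3 := le_of_iterate_Dop_deltaTuple_ne_zero h2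
    have h4 := not_rlexLT_of_le_mapAt_addOnes hi h1 (by rw [YR.tupleCard_eq, YR.tupleCard_eq])
    have h5 := not_rlexLT_of_le_mapAt_addRow hj h3 (by rw [YR.tupleCard_eq, YR.tupleCard_eq])
    rcases rlexLT_trichotomy ρ.1 μ.1 with h6 | h6 | h6
    · exact absurd h6 h5
    · exact Subtype.ext h6
    · exact absurd h6 h4

end Operators

theorem YoungDiagram.sum_rowLens (μ : YoungDiagram) : μ.rowLens.sum = μ.card := by
  rw [YoungDiagram.card, Finset.card_eq_sum_card_fiberwise (f := Prod.fst)
    (t := Finset.range (μ.colLen 0))]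
  · rw [YoungDiagram.rowLens, ← List.sum_toFinset _ (List.nodup_range), List.toFinset_range]
    exact Finset.sum_congr rfl fun i _ => μ.rowLen_eq_card
  · rintro ⟨x, y⟩ h
    rw [Finset.mem_coe, YoungDiagram.mem_cells] at h
    simp only [Finset.coe_range, Set.mem_Iio]
    exact YoungDiagram.mem_iff_lt_colLen.1 (μ.up_left_mem le_rfl (Nat.zero_le y) h)

/-- Young diagrams with `n` cells are the same as partitions of `n`. -/
noncomputable def YoungDiagram.equivPartition (n : ℕ) :
    {μ : YoungDiagram // μ.card = n} ≃ n.Partition :=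
  Equiv.ofBijective
    (fun μ => ⟨μ.1.rowLens, fun h => μ.1.pos_of_mem_rowLens _ h, by
      rw [Multiset.sum_coe, YoungDiagram.sum_rowLens, μ.2]⟩) <| by
    constructor
    · intro μ ν h
      have hp : μ.1.rowLens.Perm ν.1.rowLens := Multiset.coe_eq_coe.1 (congrArg (·.parts) h)
      exact Subtype.ext (YoungDiagram.rowLens_injective
        (hp.eq_of_pairwise (le := (· ≥ ·)) (fun a b _ _ h1 h2 => le_antisymm h2 h1)
          μ.1.rowLens_sorted.pairwise ν.1.rowLens_sorted.pairwise))
    · intro p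
      have hs : (p.parts.sort (· ≥ ·)).SortedGE := (p.parts.pairwise_sort (· ≥ ·)).sortedGE
      have hr : (YoungDiagram.ofRowLens _ hs).rowLens = p.parts.sort (· ≥ ·) :=
        YoungDiagram.rowLens_ofRowLens_eq_self fun x hx =>
          p.parts_pos ((Multiset.mem_sort _).1 hx)
      refine ⟨⟨YoungDiagram.ofRowLens _ hs, ?_⟩, ?_⟩
      · rw [← YoungDiagram.sum_rowLens, hr, ← Multiset.sum_coe, Multiset.sort_eq, p.parts_sum]
      · refine Nat.Partition.ext ?_
        change ((YoungDiagram.ofRowLens _ hs).rowLens : Multiset ℕ) = _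
        rw [hr, Multiset.sort_eq]

/-- A tuple of diagrams of total size `m` is a composition `c` of `m` into `r` parts together with
a partition of each `c i`. -/
noncomputable def YR.equivSigma (r m : ℕ) :
    YR r m ≃ Σ c : {c // c ∈ Finset.Nat.antidiagonalTuple r m}, ∀ i, (c.1 i).Partition :=
  Equiv.trans
    { toFun := fun x => ⟨⟨fun i => (x.1 i).card, Finset.Nat.mem_antidiagonalTuple.2 x.2⟩,
        fun i => ⟨x.1 i, rfl⟩⟩
      invFun := fun y => ⟨fun i => (y.2 i).1,
        (Finset.sum_congr rfl fun i _ => (y.2 i).2).trans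
          (Finset.Nat.mem_antidiagonalTuple.1 y.1.2)⟩
      left_inv := fun x => rfl
      right_inv := by
        rintro ⟨⟨c, hc⟩, y⟩
        obtain ⟨z, hz, rfl⟩ : ∃ (z : Fin r → YoungDiagram) (hz : ∀ i, (z i).card = c i),
            y = fun i => ⟨z i, hz i⟩ := ⟨fun i => (y i).1, fun i => (y i).2, rfl⟩
        obtain rfl : c = fun i => (z i).card := funext fun i => (hz i).symm
        rfl }
    (Equiv.sigmaCongrRight fun c =>
      Equiv.piCongrRight fun i => YoungDiagram.equivPartition (c.1 i))

theorem card_YR (r m : ℕ) : Fintype.card (YR r m) = pFormula r m := by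
  rw [Fintype.card_congr (YR.equivSigma r m), Fintype.card_sigma, pFormula,
    ← Finset.sum_coe_sort (Finset.Nat.antidiagonalTuple r m)
      fun c => ∏ i, Fintype.card (c i).Partition]
  exact Finset.sum_congr rfl fun c _ => by rw [Fintype.card_pi]

/-- The elements of rank `m` can be enumerated in increasing `r`-lexicographic order. -/
theorem exists_rlex_enumeration (r m : ℕ) :
    ∃ e : Fin (pFormula r m) → YR r m, ∀ a b, a < b → rlexLT (e a).1 (e b).1 := by
  let : LinearOrder (YR r m) := LinearOrder.lift' (fun x => rlexKey x.1) fun x y h =>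
    Subtype.ext (rlexKey_injective h)
  refine ⟨Fintype.orderIsoFinOfCardEq (YR r m) (card_YR r m), fun a b h => ?_⟩
  rw [← rlexKey_lt_iff]
  exact (Fintype.orderIsoFinOfCardEq (YR r m) (card_YR r m)).lt_iff_lt.2 h

theorem card_filter_mapAt {r m k : ℕ} (i : Fin r) {f : YoungDiagram → YoungDiagram}
    (hf : Function.Injective f) (hc : ∀ μ, (f μ).card = μ.card + k) (P : YoungDiagram → Prop)
    [DecidablePred fun l : YR r (m + k) => P (l.1 i)] (hP : ∀ μ, P μ ↔ ∃ ν, f ν = μ) :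
    (Finset.univ.filter fun l : YR r (m + k) => P (l.1 i)).card = pFormula r m := by
  rw [← card_YR, ← Finset.card_univ]
  symm
  refine Finset.card_bij (fun x _ => ⟨mapAt i f x.1, (tupleCard_mapAt i hc x.1).trans (by
    rw [x.tupleCard_eq])⟩) ?_ ?_ ?_
  · intro x _
    exact Finset.mem_filter.2
      ⟨Finset.mem_univ _, (hP _).2 ⟨x.1 i, (mapAt_self i f x.1).symm⟩⟩
  · intro x _ y _ h
    exact Subtype.ext (mapAt_injective i hf (congrArg Subtype.val h))
  · intro l hl
    obtain ⟨ν, hν⟩ := (hP _).1 (Finset.mem_filter.1 hl).2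
    have hl : mapAt i f (Function.update l.1 i ν) = l.1 := by simp [mapAt, hν]
    refine ⟨⟨Function.update l.1 i ν, ?_⟩, Finset.mem_univ _, Subtype.ext hl⟩
    have h := tupleCard_mapAt i hc (Function.update l.1 i ν)
    rw [hl, YR.tupleCard_eq] at h
    exact (Nat.add_right_cancel h).symm

/-- from the proof of Proposition 5.2 of the paper.  Let `M` be the
matrix of `U^kD^k` on `ℤ^{(Y^r)ₙ}`, and let
`S_k = {𝛌 : λ⁽ʳ⁾ has ≥ k parts equal to 1}`,
`T_k = {𝛌 : (λ⁽¹⁾)' has ≥ k parts equal to 1}`.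
Then `|S_k| = |T_k| = p_{n−k}`, and the submatrix `M_{S_k,T_k}`, with rows and columns
ordered `r`-lexicographically, is lower unitriangular; in particular its determinant is
`1`, so `M` has a `p_{n−k} × p_{n−k}` minor equal to `±1`. -/
theorem stmt17 (r n k : ℕ) (hr : 1 ≤ r) (hn : 1 ≤ n) (hk : k ≤ n) :
    (Finset.univ.filter fun l : YR r n =>
        k ≤ ((l.1 ⟨r - 1, by omega⟩).rowLens.count 1)).card = pFormula r (n - k) ∧
    (Finset.univ.filter fun l : YR r n =>
        k ≤ ((l.1 ⟨0, by omega⟩).transpose.rowLens.count 1)).card = pFormula r (n - k) ∧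
    ∃ es et : Fin (pFormula r (n - k)) → YR r n,
      -- `es` enumerates `S_k` in increasing `r`-lexicographic order
      Function.Injective es ∧
      (∀ a, k ≤ (((es a).1 ⟨r - 1, by omega⟩).rowLens.count 1)) ∧
      (∀ a b, a < b → rlexLT (es a).1 (es b).1) ∧
      -- `et` enumerates `T_k` in increasing `r`-lexicographic order
      Function.Injective et ∧
      (∀ a, k ≤ (((et a).1 ⟨0, by omega⟩).transpose.rowLens.count 1)) ∧
      (∀ a b, a < b → rlexLT (et a).1 (et b).1) ∧
      -- the submatrix `M_{S_k,T_k}` is lower unitriangular…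
      (∀ a, wordMatY r (List.replicate k true ++ List.replicate k false) n
          (es a) (et a) = 1) ∧
      (∀ a b, a < b →
        wordMatY r (List.replicate k true ++ List.replicate k false) n
          (es a) (et b) = 0) ∧
      -- …so its determinant is `1`: `M` has a `p_{n−k} × p_{n−k}` minor equal to `±1`
      Matrix.det (Matrix.of fun a b =>
        wordMatY r (List.replicate k true ++ List.replicate k false) n
          (es a) (et b)) = 1 := by
  obtain ⟨m, rfl⟩ := Nat.exists_eq_add_of_le' hk
  rw [Nat.add_sub_cancel]
  have hlast : ∀ l : Fin r, l ≤ ⟨r - 1, by omega⟩ := fun l => Fin.le_def.2 (by simp; omega)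
  have hfirst : ∀ l : Fin r, ⟨0, by omega⟩ ≤ l := fun l => Fin.le_def.2 (Nat.zero_le _)
  refine ⟨card_filter_mapAt _ (YoungDiagram.addOnes_injective k) (YoungDiagram.card_addOnes k)
    (fun μ => k ≤ μ.rowLens.count 1) fun _ => YoungDiagram.le_count_one_iff,
    card_filter_mapAt _ (YoungDiagram.addRow_injective k) (YoungDiagram.card_addRow k)
    (fun μ => k ≤ μ.transpose.rowLens.count 1) fun _ => YoungDiagram.le_count_one_transpose_iff, ?_⟩
  obtain ⟨e, he⟩ := exists_rlex_enumeration r m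
  have inj : ∀ f : Fin (pFormula r m) → YR r (m + k),
      (∀ a b, a < b → rlexLT (f a).1 (f b).1) → Function.Injective f := by
    intro f hf a b hab
    rcases lt_trichotomy a b with h | h | h
    · exact absurd (hab ▸ hf a b h) (rlexLT_irrefl _)
    · exact h
    · exact absurd (hab ▸ hf b a h) (rlexLT_irrefl _)
  have hs : ∀ a b, a < b → rlexLT ((e a).addOnes ⟨r - 1, by omega⟩ k).1
      ((e b).addOnes ⟨r - 1, by omega⟩ k).1 := fun a b h =>
    rlexLT_mapAt _ (fun _ _ => pLexLT_addOnes k) (he a b h)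
  have ht : ∀ a b, a < b → rlexLT ((e a).addRow ⟨0, by omega⟩ k).1
      ((e b).addRow ⟨0, by omega⟩ k).1 := fun a b h =>
    rlexLT_mapAt _ (fun _ _ => pLexLT_addRow k) (he a b h)
  have hdiag := fun a => wordMatY_addOnes_addRow_self (k := k) hlast hfirst (e a)
  have hupper := fun a b (h : a < b) =>
    wordMatY_addOnes_addRow_of_rlexLT (k := k) hlast hfirst (he a b h)
  refine ⟨fun a => (e a).addOnes ⟨r - 1, by omega⟩ k, fun a => (e a).addRow ⟨0, by omega⟩ k,
    inj _ hs, fun a => ?_, hs, inj _ ht, fun a => ?_, ht, hdiag, hupper, ?_⟩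
  · exact YoungDiagram.le_count_one_iff.2
      ⟨_, (mapAt_self _ (YoungDiagram.addOnes k) (e a).1).symm⟩
  · exact YoungDiagram.le_count_one_transpose_iff.2
      ⟨_, (mapAt_self ⟨0, hr⟩ (YoungDiagram.addRow k) (e a).1).symm⟩
  · rw [Matrix.det_of_isLowerTriangular]
    · exact Finset.prod_eq_one fun a _ => hdiag a
    · exact fun a b h => hupper a b h
end
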